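/- arXiv:2012.06288 — 3 statements merged into one kernel-verified Lean document; each statement's English description precedes it below -/
import Mathlib

section
/- Let G be a finite simple connected graph with vertex set V and edge set E, let v ∈ V, and let a^T x ≤ b be facet-defining for BOND(G). Let Ḡ be a finite simple graph with vertex set (V ∖ {v}) ∪ {v₁, v₂}, where v₁, v₂ are two new vertices, such that: v₁v₂ is an edge of Ḡ; for u, w ∈ V ∖ {v}, uw is an edge of Ḡ if and only if uw ∈ E; and for each w ∈ V ∖ {v}, exactly one of v₁w, v₂w is an edge of Ḡ when vw ∈ E, and neither is when vw ∉ E. Define φ : E(Ḡ) ∖ {v₁v₂} → E by φ(e) = e if e is disjoint from {v₁, v₂} and φ(vᵢw) = vw for i = 1, 2. Let ω be the maximum of ∑_{e ∈ δ} a_{φ(e)} over all bonds δ of the graph Ḡ − v₁v₂ (Ḡ with the edge v₁v₂ deleted) of the form δ(S) with v₁ ∈ S and v₂ ∉ S. Define ā ∈ ℝ^{E(Ḡ)} by ā_e = a_{φ(e)} for e ≠ v₁v₂ and ā_{v₁v₂} = b − ω. Then ā^T x ≤ b is facet-defining for BOND(Ḡ). -/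
open Finset

namespace BondPolytope

variable {V : Type*}

/-- The cut `δ(S)`: edges of `G` with exactly one endpoint in `S`. -/
def cut (G : SimpleGraph V) (S : Set V) : Set (Sym2 V) :=
  {e | e ∈ G.edgeSet ∧ ∃ u w, e = s(u, w) ∧ u ∈ S ∧ w ∉ S}

/-- A set of edges is a cut of `G`. -/
def IsCut (G : SimpleGraph V) (D : Set (Sym2 V)) : Prop :=
  ∃ S : Set V, D = cut G S

/-- A set of edges is a bond of `G`: it is a cut `δ(S)` such that both sides induce
connected (possibly empty) subgraphs. -/
def IsBond (G : SimpleGraph V) (D : Set (Sym2 V)) : Prop :=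
  ∃ S : Set V, D = cut G S ∧ (G.induce S).Preconnected ∧ (G.induce Sᶜ).Preconnected

open Classical in
/-- The indicator vector `x^δ ∈ ℝ^E` of a set `δ` of edges. -/
noncomputable def indVec (G : SimpleGraph V) (D : Set (Sym2 V)) : ↥G.edgeSet → ℝ :=
  fun e => if (e : Sym2 V) ∈ D then 1 else 0

/-- The bond polytope `BOND(G) ⊆ ℝ^E`. -/
noncomputable def bondPolytope (G : SimpleGraph V) : Set (↥G.edgeSet → ℝ) :=
  convexHull ℝ {x | ∃ D, IsBond G D ∧ x = indVec G D}

/-- The cut polytope `CUT(G) ⊆ ℝ^E`. -/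
noncomputable def cutPolytope (G : SimpleGraph V) : Set (↥G.edgeSet → ℝ) :=
  convexHull ℝ {x | ∃ D, IsCut G D ∧ x = indVec G D}

/-- `a^T x`. -/
noncomputable def dot {ι : Type*} [Fintype ι] (a x : ι → ℝ) : ℝ := ∑ i, a i * x i

/-- Affine dimension of a set of points. -/
noncomputable def affDim {W : Type*} [AddCommGroup W] [Module ℝ W] (s : Set W) : ℕ :=
  Module.finrank ℝ ↥(vectorSpan ℝ s)

/-- `a^T x ≤ b` is facet-defining for `P`. -/
def IsFacet {ι : Type*} [Fintype ι] (P : Set (ι → ℝ)) (a : ι → ℝ) (b : ℝ) : Prop :=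
  a ≠ 0 ∧ (∀ x ∈ P, dot a x ≤ b) ∧ {x ∈ P | dot a x = b}.Nonempty ∧
    affDim {x ∈ P | dot a x = b} + 1 = affDim P


/-! ### Connected vertex sets -/

/-- Every partition of `S` into two nonempty parts is crossed by an edge of `H`. -/
def CutConnected (H : SimpleGraph V) (S : Set V) : Prop :=
  ∀ T : Set V, (S ∩ T).Nonempty → (S \ T).Nonempty → ∃ u ∈ S ∩ T, ∃ w ∈ S \ T, H.Adj u w

theorem induce_preconnected_iff_cutConnected (H : SimpleGraph V) (S : Set V) :
    (H.induce S).Preconnected ↔ CutConnected H S := by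
  constructor
  · rintro h T ⟨x, hxS, hxT⟩ ⟨y, hyS, hyT⟩
    obtain ⟨p⟩ := h ⟨x, hxS⟩ ⟨y, hyS⟩
    obtain ⟨d, -, hd₁, hd₂⟩ := p.exists_boundary_dart (Subtype.val ⁻¹' T) hxT hyT
    exact ⟨d.fst, ⟨d.fst.2, hd₁⟩, d.snd, ⟨d.snd.2, hd₂⟩, d.adj⟩
  · rintro h ⟨x, hx⟩ ⟨y, hy⟩
    by_contra hxy
    obtain ⟨u, ⟨hu, hu', hxu⟩, w, ⟨hw, hw'⟩, huw⟩ :=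
      h {z | ∃ hz : z ∈ S, (H.induce S).Reachable ⟨x, hx⟩ ⟨z, hz⟩} ⟨x, hx, hx, .refl _⟩
        ⟨y, hy, fun ⟨_, h'⟩ => hxy h'⟩
    have hadj : (H.induce S).Adj ⟨u, hu⟩ ⟨w, hw⟩ := huw
    exact hw' ⟨hw, hxu.trans hadj.reachable⟩

theorem cutConnected_univ {H : SimpleGraph V} (hH : H.Preconnected) :
    CutConnected H Set.univ := by
  rintro T ⟨x, -, hxT⟩ ⟨y, -, hyT⟩
  obtain ⟨p⟩ := hH x y
  obtain ⟨d, -, hd₁, hd₂⟩ := p.exists_boundary_dart T hxT hyT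
  exact ⟨d.fst, ⟨trivial, hd₁⟩, d.snd, ⟨trivial, hd₂⟩, d.adj⟩

theorem isBond_cut {H : SimpleGraph V} {S : Set V} (h : CutConnected H S)
    (h' : CutConnected H Sᶜ) : IsBond H (cut H S) :=
  ⟨S, rfl, (induce_preconnected_iff_cutConnected H S).2 h,
    (induce_preconnected_iff_cutConnected H Sᶜ).2 h'⟩

theorem IsBond.exists_cutConnected {H : SimpleGraph V} {D : Set (Sym2 V)} (h : IsBond H D) :
    ∃ S, D = cut H S ∧ CutConnected H S ∧ CutConnected H Sᶜ := by
  obtain ⟨S, hD, h₁, h₂⟩ := h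
  exact ⟨S, hD, (induce_preconnected_iff_cutConnected H S).1 h₁,
    (induce_preconnected_iff_cutConnected H Sᶜ).1 h₂⟩

theorem cutConnected_empty (H : SimpleGraph V) : CutConnected H ∅ := by
  rintro T ⟨x, hx, -⟩
  exact hx.elim

theorem mk_mem_cut {H : SimpleGraph V} {S : Set V} {u w : V} :
    s(u, w) ∈ cut H S ↔ H.Adj u w ∧ (u ∈ S ↔ w ∉ S) := by
  simp only [cut, Set.mem_ofPred_eq, SimpleGraph.mem_edgeSet, Sym2.eq_iff]
  refine and_congr_right fun _ => ?_
  constructor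
  · rintro ⟨x, y, ⟨rfl, rfl⟩ | ⟨rfl, rfl⟩, hx, hy⟩ <;> simp [hx, hy]
  · intro h
    by_cases hu : u ∈ S
    · exact ⟨u, w, .inl ⟨rfl, rfl⟩, hu, h.1 hu⟩
    · exact ⟨w, u, .inr ⟨rfl, rfl⟩, by tauto, hu⟩

theorem cut_compl (H : SimpleGraph V) (S : Set V) : cut H Sᶜ = cut H S := by
  ext e
  induction e with
  | _ u w => simp only [mk_mem_cut, Set.mem_compl_iff]; tauto

/-! ### The bond polytope of a connected graph is full-dimensional -/

/-- A minimal nonempty union of components of `Sᶜ` is connected, as are its complement and its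
union with `S`. -/
theorem exists_component_compl [Finite V] {H : SimpleGraph V} (hH : CutConnected H Set.univ)
    {S : Set V} (hS : CutConnected H S) (hne : S.Nonempty) (hne' : Sᶜ.Nonempty) :
    ∃ C : Set V, C.Nonempty ∧ C ⊆ Sᶜ ∧ (∀ u ∈ C, ∀ w ∉ C, H.Adj u w → w ∈ S) ∧
      CutConnected H C ∧ CutConnected H Cᶜ ∧ CutConnected H (S ∪ C) := by
  obtain ⟨C, ⟨hC, hCS, hout⟩, hmin⟩ := Set.Finite.exists_minimal
    (Set.toFinite {C : Set V | C.Nonempty ∧ C ⊆ Sᶜ ∧ ∀ u ∈ C, ∀ w ∉ C, H.Adj u w → w ∈ S})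
    ⟨Sᶜ, hne', subset_rfl, fun u _ w hw _ => by simpa using hw⟩
  have hCc : CutConnected H C := by
    rintro T hT ⟨y, hyC, hyT⟩
    by_contra! hno
    refine hyT (hmin ⟨hT, fun x hx => hCS hx.1, fun u hu w hw huw => ?_⟩
      Set.inter_subset_left hyC).2
    by_cases hwC : w ∈ C
    · exact (hno u hu w ⟨hwC, fun hwT => hw ⟨hwC, hwT⟩⟩ huw).elim
    · exact hout u hu.1 w hwC huw
  have hCCaux : ∀ T : Set V, (Cᶜ ∩ T).Nonempty → (Cᶜ \ T).Nonempty → S ∩ T = ∅ →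
      ∃ u ∈ Cᶜ ∩ T, ∃ w ∈ Cᶜ \ T, H.Adj u w := by
    rintro T ⟨x, hxC, hxT⟩ ⟨y, hyC, hyT⟩ hST
    obtain ⟨u, ⟨-, huT, huC⟩, w, ⟨-, hw⟩, huw⟩ :=
      hH (T \ C) ⟨x, trivial, hxT, hxC⟩ ⟨y, trivial, fun h => hyT h.1⟩
    have hwC : w ∉ C := fun hwC =>
      Set.eq_empty_iff_forall_notMem.1 hST u ⟨hout w hwC u huC huw.symm, huT⟩
    exact ⟨u, ⟨huC, huT⟩, w, ⟨hwC, fun hwT => hw ⟨hwT, hwC⟩⟩, huw⟩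
  refine ⟨C, hC, hCS, hout, hCc, ?_, ?_⟩
  · intro T hT hT'
    rcases Set.eq_empty_or_nonempty (S ∩ T) with h | h
    · exact hCCaux T hT hT' h
    rcases Set.eq_empty_or_nonempty (S \ T) with h' | h'
    · obtain ⟨u, hu, w, hw, huw⟩ := hCCaux Tᶜ hT' (by simpa [Set.sdiff_eq] using hT) h'
      exact ⟨w, ⟨hw.1, not_not.1 hw.2⟩, u, hu, huw.symm⟩
    · obtain ⟨u, hu, w, hw, huw⟩ := hS T h h'
      exact ⟨u, ⟨fun huC => hCS huC hu.1, hu.2⟩, w, ⟨fun hwC => hCS hwC hw.1, hw.2⟩, huw⟩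
  · obtain ⟨s, hs⟩ := hne
    obtain ⟨c, ⟨-, hc⟩, t, ⟨-, ht⟩, hct⟩ :=
      hH C (by simpa using hC) ⟨s, trivial, fun hsC => hCS hsC hs⟩
    have htS := hout c hc t ht hct
    intro T hT hT'
    by_cases h₁ : (S ∩ T).Nonempty ∧ (S \ T).Nonempty
    · obtain ⟨u, hu, w, hw, huw⟩ := hS T h₁.1 h₁.2
      exact ⟨u, ⟨.inl hu.1, hu.2⟩, w, ⟨.inl hw.1, hw.2⟩, huw⟩
    by_cases h₂ : (C ∩ T).Nonempty ∧ (C \ T).Nonempty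
    · obtain ⟨u, hu, w, hw, huw⟩ := hCc T h₂.1 h₂.2
      exact ⟨u, ⟨.inr hu.1, hu.2⟩, w, ⟨.inr hw.1, hw.2⟩, huw⟩
    by_cases hcT : c ∈ T <;> by_cases htT : t ∈ T
    · exfalso
      obtain ⟨y, hy | hy, hyT⟩ := hT'
      · exact h₁ ⟨⟨t, htS, htT⟩, y, hy, hyT⟩
      · exact h₂ ⟨⟨c, hc, hcT⟩, y, hy, hyT⟩
    · exact ⟨c, ⟨.inr hc, hcT⟩, t, ⟨.inl htS, htT⟩, hct⟩
    · exact ⟨t, ⟨.inl htS, htT⟩, c, ⟨.inr hc, hcT⟩, hct.symm⟩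
    · exfalso
      obtain ⟨y, hy | hy, hyT⟩ := hT
      · exact h₁ ⟨⟨y, hy, hyT⟩, t, htS, htT⟩
      · exact h₂ ⟨⟨y, hy, hyT⟩, c, hc, hcT⟩

theorem indVec_cut_mem_span [Finite V] {H : SimpleGraph V} (hH : CutConnected H Set.univ)
    {S : Set V} (hS : CutConnected H S) (hne : S.Nonempty) :
    indVec H (cut H S) ∈ Submodule.span ℝ {x | ∃ D, IsBond H D ∧ x = indVec H D} := by
  classical
  induction hn : Sᶜ.ncard using Nat.strong_induction_on generalizing S with
  | _ n ih =>
    rcases Set.eq_empty_or_nonempty Sᶜ with h | h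
    · exact Submodule.subset_span ⟨_, isBond_cut hS (h ▸ cutConnected_empty H), rfl⟩
    obtain ⟨C, hC, hCS, hout, hCc, hCc', hSC⟩ := exists_component_compl hH hS hne h
    have hsum : indVec H (cut H S) = indVec H (cut H C) + indVec H (cut H (S ∪ C)) := by
      ext ⟨e, he⟩
      induction e with
      | _ u w =>
        have huw : H.Adj u w := he
        have h₁ := hout u
        have h₂ := hout w
        have h₃ := @hCS u
        have h₄ := @hCS w
        simp only [Set.mem_compl_iff] at h₃ h₄
        simp only [indVec, Pi.add_apply, mk_mem_cut, huw, true_and, Set.mem_union]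
        by_cases huS : u ∈ S <;> by_cases hwS : w ∈ S <;> by_cases huC : u ∈ C <;>
          by_cases hwC : w ∈ C <;> simp_all [huw.symm]
    rw [hsum]
    refine Submodule.add_mem _ (Submodule.subset_span ⟨_, isBond_cut hCc hCc', rfl⟩)
      (ih _ ?_ hSC (hne.mono Set.subset_union_left) rfl)
    rw [← hn]
    refine Set.ncard_lt_ncard ⟨by simp, fun hsub => ?_⟩ (Set.toFinite _)
    obtain ⟨c, hc⟩ := hC
    exact hsub (hCS hc) (.inr hc)

theorem cutConnected_singleton (H : SimpleGraph V) (u : V) : CutConnected H {u} := by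
  rintro T ⟨x, rfl, hx⟩ ⟨y, rfl, hy⟩
  exact (hy hx).elim

theorem cutConnected_pair {H : SimpleGraph V} {u w : V} (h : H.Adj u w) :
    CutConnected H {u, w} := by
  rintro T ⟨x, rfl | rfl, hx⟩ ⟨y, rfl | rfl, hy⟩
  · exact (hy hx).elim
  · exact ⟨x, ⟨by simp, hx⟩, y, ⟨by simp, hy⟩, h⟩
  · exact ⟨x, ⟨by simp, hx⟩, y, ⟨by simp, hy⟩, h.symm⟩
  · exact (hy hx).elim

theorem span_indVec_bond_eq_top [Finite V] {H : SimpleGraph V}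
    (hH : CutConnected H Set.univ) :
    Submodule.span ℝ {x | ∃ D, IsBond H D ∧ x = indVec H D} = ⊤ := by
  classical
  have := Fintype.ofFinite H.edgeSet
  rw [eq_top_iff, ← (Pi.basisFun ℝ H.edgeSet).span_eq, Submodule.span_le]
  rintro _ ⟨⟨e, he⟩, rfl⟩
  induction e with
  | _ u w =>
    have huw : H.Adj u w := he
    have hkey : Pi.basisFun ℝ H.edgeSet ⟨s(u, w), he⟩ = (1 / 2 : ℝ) •
        (indVec H (cut H {u}) + indVec H (cut H {w}) - indVec H (cut H {u, w})) := by
      ext ⟨f, hf⟩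
      induction f with
      | _ x y =>
        have hxy : H.Adj x y := hf
        have hne := huw.ne
        have hne' := hxy.ne
        simp only [Pi.basisFun_apply, Pi.single_apply, Subtype.mk.injEq, Sym2.eq_iff, indVec,
          Pi.smul_apply, Pi.add_apply, Pi.sub_apply, mk_mem_cut, hxy, true_and,
          Set.mem_singleton_iff, Set.mem_insert_iff, smul_eq_mul]
        by_cases h₁ : x = u <;> by_cases h₂ : x = w <;> by_cases h₃ : y = u <;>
          by_cases h₄ : y = w <;> simp_all <;> norm_num
    rw [hkey]
    exact Submodule.smul_mem _ _ (Submodule.sub_mem _ (Submodule.add_mem _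
      (indVec_cut_mem_span hH (cutConnected_singleton H u) (by simp))
      (indVec_cut_mem_span hH (cutConnected_singleton H w) (by simp)))
      (indVec_cut_mem_span hH (cutConnected_pair huw) (by simp)))

theorem affDim_bondPolytope {H : SimpleGraph V} [Finite V] [Fintype H.edgeSet]
    (hH : CutConnected H Set.univ) :
    affDim (bondPolytope H) = Fintype.card H.edgeSet := by
  have h0 : (0 : H.edgeSet → ℝ) ∈ bondPolytope H := by
    refine subset_convexHull ℝ _ ⟨_, isBond_cut (cutConnected_empty H)
      (by rwa [Set.compl_empty]), ?_⟩
    ext e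
    simp [indVec, cut]
  have htop : vectorSpan ℝ (bondPolytope H) = ⊤ := by
    rw [eq_top_iff, ← span_indVec_bond_eq_top hH, Submodule.span_le]
    intro x hx
    have hx' : x ∈ bondPolytope H := subset_convexHull ℝ _ hx
    simpa using vsub_mem_vectorSpan ℝ hx' h0
  rw [affDim, htop, finrank_top, Module.finrank_fintype_fun_eq_card]

/-! ### Linear functionals and faces -/

/-- `dot a` as a linear functional. -/
noncomputable def dotLin {ι : Type*} [Fintype ι] (a : ι → ℝ) : (ι → ℝ) →ₗ[ℝ] ℝ where
  toFun := dot a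
  map_add' x y := by simp [dot, mul_add, Finset.sum_add_distrib]
  map_smul' c x := by simp [dot, Finset.mul_sum, mul_left_comm]

theorem dotLin_apply {ι : Type*} [Fintype ι] (a x : ι → ℝ) : dotLin a x = dot a x := rfl

theorem dotLin_ne_zero {ι : Type*} [Fintype ι] {a : ι → ℝ} (ha : a ≠ 0) : dotLin a ≠ 0 := by
  classical
  intro h
  refine ha (funext fun i => ?_)
  simpa [dotLin_apply, dot, Pi.single_apply] using LinearMap.congr_fun h (Pi.single i 1)

theorem affDim_face_lt {ι : Type*} [Fintype ι] (P : Set (ι → ℝ)) {a : ι → ℝ} (ha : a ≠ 0)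
    (b : ℝ) : affDim {x ∈ P | dot a x = b} < Fintype.card ι := by
  have hle : vectorSpan ℝ {x ∈ P | dot a x = b} ≤ LinearMap.ker (dotLin a) := by
    rw [vectorSpan_def, Submodule.span_le]
    rintro _ ⟨x, hx, y, hy, rfl⟩
    change dotLin a (x - y) = 0
    rw [map_sub, dotLin_apply, dotLin_apply, hx.2, hy.2, sub_self]
  have h₁ := Submodule.finrank_mono hle
  have h₂ := Module.Dual.finrank_ker_add_one_of_ne_zero (dotLin_ne_zero ha)
  rw [Module.finrank_fintype_fun_eq_card] at h₂
  change Module.finrank ℝ _ < _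
  omega

theorem dot_le_of_mem_convexHull {ι : Type*} [Fintype ι] {s : Set (ι → ℝ)} {a : ι → ℝ} {b : ℝ}
    (h : ∀ x ∈ s, dot a x ≤ b) : ∀ x ∈ convexHull ℝ s, dot a x ≤ b :=
  convexHull_min h (convex_halfSpace_le (dotLin a).isLinear b)

/-! ### Node splitting -/

/-- `Gbar` arises from `G` by splitting `v` into the adjacent nodes `none` and `some v`. -/
structure IsSplitting (G : SimpleGraph V) (v : V) (Gbar : SimpleGraph (Option V)) : Prop where
  adj_new : Gbar.Adj none (some v)
  adj_old : ∀ u w : V, u ≠ v → w ≠ v → (Gbar.Adj (some u) (some w) ↔ G.Adj u w)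
  not_both : ∀ w : V, w ≠ v → ¬(Gbar.Adj none (some w) ∧ Gbar.Adj (some v) (some w))
  distrib : ∀ w : V, w ≠ v →
    ((Gbar.Adj none (some w) ∨ Gbar.Adj (some v) (some w)) ↔ G.Adj v w)

namespace IsSplitting

variable {G : SimpleGraph V} {v : V} {Gbar : SimpleGraph (Option V)}

theorem adj_getD (h : IsSplitting G v Gbar) {x y : Option V} (hxy : Gbar.Adj x y)
    (hne : x.getD v ≠ y.getD v) : G.Adj (x.getD v) (y.getD v) := by
  obtain ⟨h₁, h₂, h₃, h₄⟩ := h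
  have := hxy.symm
  have hsymm := G.adj_comm
  rcases x with _ | x <;> rcases y with _ | y <;>
    simp only [Option.getD_none, Option.getD_some] at *
  · exact (hne rfl).elim
  · exact (h₄ y hne.symm).1 (.inl hxy)
  · exact ((h₄ x hne).1 (.inl this)).symm
  · by_cases hx : x = v
    · subst hx; exact (h₄ y hne.symm).1 (.inr hxy)
    by_cases hy : y = v
    · subst hy; exact ((h₄ x hne).1 (.inr this)).symm
    exact (h₂ x y hx hy).1 hxy

theorem eq_of_getD_eq {x y : Option V} (hxy : Gbar.Adj x y) (he : x.getD v = y.getD v) :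
    s(x, y) = s(none, some v) := by
  have := hxy.ne
  rcases x with _ | x <;> rcases y with _ | y <;> simp_all

theorem exists_adj (h : IsSplitting G v Gbar) {u w : V} (huw : G.Adj u w) :
    ∃ x y : Option V, x.getD v = u ∧ y.getD v = w ∧ Gbar.Adj x y := by
  obtain ⟨h₁, h₂, h₃, h₄⟩ := h
  have hne := huw.ne
  by_cases hu : u = v
  · subst hu
    rcases (h₄ w hne.symm).2 huw with h | h
    exacts [⟨_, _, rfl, rfl, h⟩, ⟨_, _, rfl, rfl, h⟩]
  by_cases hw : w = v
  · subst hw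
    rcases (h₄ u hne).2 huw.symm with h | h
    exacts [⟨_, _, rfl, rfl, h.symm⟩, ⟨_, _, rfl, rfl, h.symm⟩]
  exact ⟨some u, some w, rfl, rfl, (h₂ u w hu hw).2 huw⟩

theorem eq_of_adj_of_getD_eq (h : IsSplitting G v Gbar) {x y x' y' : Option V}
    (hxy : Gbar.Adj x y) (hxy' : Gbar.Adj x' y') (hx : x.getD v = x'.getD v)
    (hy : y.getD v = y'.getD v) (hne : x.getD v ≠ y.getD v) : x = x' ∧ y = y' := by
  have h₃ := h.not_both
  have := hxy.symm
  have := hxy'.symm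
  rcases x with _ | x <;> rcases y with _ | y <;> rcases x' with _ | x' <;>
    rcases y' with _ | y' <;> simp only [Option.getD_none, Option.getD_some] at * <;> grind

theorem map_mem_edgeSet_iff (h : IsSplitting G v Gbar) {e : Sym2 (Option V)}
    (he : e ∈ Gbar.edgeSet) :
    e.map (fun x => x.getD v) ∈ G.edgeSet ↔ e ≠ s(none, some v) := by
  induction e with
  | _ x y =>
    refine ⟨?_, fun hne => h.adj_getD he fun heq => hne (eq_of_getD_eq he heq)⟩
    intro hG heq
    simp only [heq, Sym2.map_mk, Option.getD_none, Option.getD_some] at hG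
    exact hG.ne rfl

theorem map_injOn (h : IsSplitting G v Gbar) {e f : Sym2 (Option V)} (he : e ∈ Gbar.edgeSet)
    (hf : f ∈ Gbar.edgeSet) (hne : e ≠ s(none, some v))
    (hef : e.map (fun x => x.getD v) = f.map (fun x => x.getD v)) : e = f := by
  induction e with
  | _ x y =>
  induction f with
  | _ x' y' =>
    have hxy : x.getD v ≠ y.getD v := fun heq => hne (eq_of_getD_eq he heq)
    simp only [Sym2.map_mk, Sym2.eq_iff] at hef
    rcases hef with ⟨h₁, h₂⟩ | ⟨h₁, h₂⟩
    · obtain ⟨rfl, rfl⟩ := h.eq_of_adj_of_getD_eq he hf h₁ h₂ hxy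
      rfl
    · obtain ⟨rfl, rfl⟩ := h.eq_of_adj_of_getD_eq he (SimpleGraph.Adj.symm hf) h₁ h₂ hxy
      exact Sym2.eq_swap

theorem exists_lift (h : IsSplitting G v Gbar) (f : G.edgeSet) :
    ∃ e : Gbar.edgeSet, (e : Sym2 (Option V)).map (fun x => x.getD v) = f := by
  obtain ⟨f, hf⟩ := f
  induction f with
  | _ u w =>
    obtain ⟨x, y, rfl, rfl, hxy⟩ := h.exists_adj hf
    exact ⟨⟨s(x, y), hxy⟩, rfl⟩

/-- The edge of `Gbar` lying over an edge of `G`. -/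
noncomputable def lift (h : IsSplitting G v Gbar) (f : G.edgeSet) : Gbar.edgeSet :=
  (h.exists_lift f).choose

theorem map_lift (h : IsSplitting G v Gbar) (f : G.edgeSet) :
    (h.lift f : Sym2 (Option V)).map (fun x => x.getD v) = f :=
  (h.exists_lift f).choose_spec

theorem lift_ne (h : IsSplitting G v Gbar) (f : G.edgeSet) :
    (h.lift f : Sym2 (Option V)) ≠ s(none, some v) :=
  (h.map_mem_edgeSet_iff (h.lift f).2).1 (by rw [h.map_lift]; exact f.2)

/-- The new edge. -/
def newEdge (h : IsSplitting G v Gbar) : Gbar.edgeSet := ⟨s(none, some v), h.adj_new⟩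

theorem sum_edgeSet (h : IsSplitting G v Gbar) [Fintype G.edgeSet] [Fintype Gbar.edgeSet]
    (g : Gbar.edgeSet → ℝ) : ∑ e, g e = g h.newEdge + ∑ f, g (h.lift f) := by
  have hbij : Function.Bijective (fun o : Option G.edgeSet => o.elim h.newEdge h.lift) := by
    constructor
    · have hn : ∀ f, h.lift f ≠ h.newEdge := fun f hf => h.lift_ne f (congrArg Subtype.val hf)
      rintro (_ | f) (_ | f') hff
      · rfl
      · exact (hn f' hff.symm).elim
      · exact (hn f hff).elim
      · refine congrArg some (Subtype.ext ?_)
        rw [← h.map_lift f, ← h.map_lift f']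
        exact congrArg (fun e : Gbar.edgeSet => Sym2.map (fun x => x.getD v) (e : Sym2 (Option V)))
          hff
    · intro e
      by_cases he : (e : Sym2 (Option V)) = s(none, some v)
      · exact ⟨none, Subtype.ext he.symm⟩
      · refine ⟨some ⟨_, (h.map_mem_edgeSet_iff e.2).2 he⟩, Subtype.ext ?_⟩
        exact h.map_injOn (h.lift _).2 e.2 (h.lift_ne _) (h.map_lift _)
  rw [← (Equiv.ofBijective _ hbij).sum_comp g, Fintype.sum_option]
  rfl

theorem dot_eq (h : IsSplitting G v Gbar) [Fintype G.edgeSet] [Fintype Gbar.edgeSet]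
    {a : G.edgeSet → ℝ} {abar : Gbar.edgeSet → ℝ} (ha : ∀ f, abar (h.lift f) = a f)
    (y : Gbar.edgeSet → ℝ) :
    dot abar y = abar h.newEdge * y h.newEdge + dot a (fun f => y (h.lift f)) := by
  simp only [dot, h.sum_edgeSet, ha]

open Classical in
/-- Extension of a vector by zero on the new edge. -/
noncomputable def extend (_h : IsSplitting G v Gbar) :
    (G.edgeSet → ℝ) →ₗ[ℝ] (Gbar.edgeSet → ℝ) where
  toFun x e := if he : (e : Sym2 (Option V)).map (fun x => x.getD v) ∈ G.edgeSet
    then x ⟨_, he⟩ else 0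
  map_add' x y := by ext e; simp only [Pi.add_apply]; split_ifs <;> simp
  map_smul' c x := by ext e; simp only [Pi.smul_apply]; split_ifs <;> simp

theorem extend_lift (h : IsSplitting G v Gbar) (x : G.edgeSet → ℝ) (f : G.edgeSet) :
    h.extend x (h.lift f) = x f := by
  have hf := h.map_lift f
  simp [extend, hf]

theorem extend_newEdge (h : IsSplitting G v Gbar) (x : G.edgeSet → ℝ) :
    h.extend x h.newEdge = 0 :=
  dif_neg fun hmem => (h.map_mem_edgeSet_iff h.newEdge.2).1 hmem rfl

theorem extend_injective (h : IsSplitting G v Gbar) : Function.Injective h.extend := by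
  intro x y hxy
  ext f
  rw [← h.extend_lift x f, hxy, h.extend_lift]

theorem mem_cut_preimage (h : IsSplitting G v Gbar) (S : Set V) {e : Sym2 (Option V)}
    (he : e ∈ Gbar.edgeSet) :
    e ∈ cut Gbar ((fun x => x.getD v) ⁻¹' S) ↔ e.map (fun x => x.getD v) ∈ cut G S := by
  induction e with
  | _ x y =>
    have hxy : Gbar.Adj x y := he
    simp only [Sym2.map_mk, mk_mem_cut, Set.mem_preimage, hxy, true_and]
    refine ⟨fun hS => ⟨h.adj_getD hxy fun heq => ?_, hS⟩, And.right⟩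
    rw [heq] at hS
    tauto

theorem extend_indVec_cut (h : IsSplitting G v Gbar) (S : Set V) :
    h.extend (indVec G (cut G S)) = indVec Gbar (cut Gbar ((fun x => x.getD v) ⁻¹' S)) := by
  classical
  ext e
  by_cases he : (e : Sym2 (Option V)).map (fun x => x.getD v) ∈ G.edgeSet
  · simp [extend, indVec, he, h.mem_cut_preimage S e.2]
  · have : (e : Sym2 (Option V)).map (fun x => x.getD v) ∉ cut G S := fun hc => he hc.1
    simp [extend, indVec, he, h.mem_cut_preimage S e.2, this]

theorem cutConnected_preimage (h : IsSplitting G v Gbar) {S : Set V} :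
    CutConnected Gbar ((fun x => x.getD v) ⁻¹' S) ↔ CutConnected G S := by
  constructor
  · rintro hS T ⟨x, hxS, hxT⟩ ⟨y, hyS, hyT⟩
    obtain ⟨u, hu, w, hw, huw⟩ :=
      hS ((fun x => x.getD v) ⁻¹' T) ⟨some x, hxS, hxT⟩ ⟨some y, hyS, hyT⟩
    exact ⟨_, hu, _, hw, h.adj_getD huw fun heq =>
      hw.2 (Set.mem_preimage.2 (heq ▸ Set.mem_preimage.1 hu.2))⟩
  · intro hS T hT hT'
    by_cases hsep : v ∈ S ∧ ¬(none ∈ T ↔ some v ∈ T)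
    · by_cases hn : none ∈ T
      · exact ⟨none, ⟨hsep.1, hn⟩, some v, ⟨hsep.1, by tauto⟩, h.adj_new⟩
      · exact ⟨some v, ⟨hsep.1, by tauto⟩, none, ⟨hsep.1, hn⟩, h.adj_new.symm⟩
    have key : ∀ x : Option V, x.getD v ∈ S → (x ∈ T ↔ some (x.getD v) ∈ T) := by
      rintro (_ | x) hx
      · simp only [Option.getD_none] at hx ⊢
        tauto
      · rfl
    obtain ⟨x, hxS, hxT⟩ := hT
    obtain ⟨y, hyS, hyT⟩ := hT'
    obtain ⟨u, ⟨huS, huT⟩, w, ⟨hwS, hwT⟩, huw⟩ := hS (some ⁻¹' T)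
      ⟨_, hxS, (key x hxS).1 hxT⟩ ⟨_, hyS, fun hy => hyT ((key y hyS).2 hy)⟩
    obtain ⟨p, q, rfl, rfl, hpq⟩ := h.exists_adj huw
    exact ⟨p, ⟨huS, (key p huS).2 huT⟩, q, ⟨hwS, fun hq => hwT ((key q hwS).1 hq)⟩, hpq⟩

theorem extend_mem_bondPolytope (h : IsSplitting G v Gbar) {x : G.edgeSet → ℝ}
    (hx : x ∈ bondPolytope G) : h.extend x ∈ bondPolytope Gbar := by
  have hx' := Set.mem_image_of_mem h.extend hx
  rw [bondPolytope, LinearMap.image_convexHull] at hx'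
  refine convexHull_mono ?_ hx'
  rintro _ ⟨_, ⟨D, hD, rfl⟩, rfl⟩
  obtain ⟨S, rfl, h₁, h₂⟩ := hD.exists_cutConnected
  refine ⟨_, isBond_cut (h.cutConnected_preimage.2 h₁) ?_, h.extend_indVec_cut S⟩
  rw [← Set.preimage_compl]
  exact h.cutConnected_preimage.2 h₂

theorem indVec_cut_lift (h : IsSplitting G v Gbar) (S : Set (Option V)) :
    (fun f => indVec Gbar (cut Gbar S) (h.lift f)) =
      indVec G (Sym2.map (fun x => x.getD v) ''
        cut (Gbar.deleteEdges {s(none, some v)}) S) := by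
  classical
  ext f
  refine if_congr ⟨fun hf => ⟨h.lift f, ⟨?_, hf.2⟩, h.map_lift f⟩, ?_⟩ rfl rfl
  · rw [SimpleGraph.edgeSet_deleteEdges]
    exact ⟨hf.1, h.lift_ne f⟩
  · rintro ⟨e, ⟨he, hcut⟩, hef⟩
    rw [SimpleGraph.edgeSet_deleteEdges] at he
    have : e = h.lift f := h.map_injOn he.1 (h.lift f).2 he.2 (by rw [hef, h.map_lift])
    exact this ▸ ⟨he.1, hcut⟩

theorem newEdge_mem_cut (h : IsSplitting G v Gbar) {S : Set (Option V)} (hn : none ∈ S)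
    (hv : some v ∉ S) : indVec Gbar (cut Gbar S) h.newEdge = 1 :=
  if_pos (mk_mem_cut.2 ⟨h.adj_new, by simp [hn, hv]⟩)

end IsSplitting

theorem cutConnected_deleteEdges_iff {H : SimpleGraph V} {u w : V} {S : Set V}
    (hS : ¬(u ∈ S ∧ w ∈ S)) :
    CutConnected (H.deleteEdges {s(u, w)}) S ↔ CutConnected H S := by
  refine forall_congr' fun T => imp_congr_right fun _ => imp_congr_right fun _ =>
    exists_congr fun x => and_congr_right fun hx => exists_congr fun y =>
    and_congr_right fun hy => ?_
  simp only [SimpleGraph.deleteEdges_adj, Set.mem_singleton_iff, and_iff_left_iff_imp]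
  intro _ heq
  rcases Sym2.eq_iff.1 heq with ⟨rfl, rfl⟩ | ⟨rfl, rfl⟩
  · exact hS ⟨hx.1, hy.1⟩
  · exact hS ⟨hy.1, hx.1⟩

/-- A bond of the form `cut H S` with `u ∈ S` and `w ∉ S` is the cut of a set with connected sides
that also separates `u` from `w`. -/
theorem exists_separating_of_isBond_cut {H : SimpleGraph V} {S : Set V} {u w : V} (hu : u ∈ S)
    (hw : w ∉ S) (hb : IsBond H (cut H S)) :
    ∃ S', u ∈ S' ∧ w ∉ S' ∧ cut H S' = cut H S ∧ CutConnected H S' ∧ CutConnected H S'ᶜ := by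
  have key : ∀ R : Set V, CutConnected H R → cut H R = cut H S → u ∈ R → w ∉ R := by
    intro R hR hcut huR hwR
    obtain ⟨x, hx, y, hy, hxy⟩ := hR S ⟨u, huR, hu⟩ ⟨w, hwR, hw⟩
    have hmem : s(x, y) ∈ cut H R := hcut ▸ mk_mem_cut.2 ⟨hxy, by simp [hx.2, hy.2]⟩
    exact ((mk_mem_cut.1 hmem).2.1 hx.1) hy.1
  obtain ⟨R, hcut, h₁, h₂⟩ := hb.exists_cutConnected
  by_cases huR : u ∈ R
  · exact ⟨R, huR, key R h₁ hcut.symm huR, hcut.symm, h₁, h₂⟩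
  · have hcut' : cut H Rᶜ = cut H S := by rw [cut_compl, hcut]
    exact ⟨Rᶜ, huR, key _ h₂ hcut' huR, hcut', h₂, by rwa [compl_compl]⟩

theorem node_splitting {V : Type*} [Fintype V] [DecidableEq V]
    (G : SimpleGraph V) [DecidableRel G.Adj] (hG : G.Connected)
    (v : V) (a : ↥G.edgeSet → ℝ) (b : ℝ) (hfacet : IsFacet (bondPolytope G) a b)
    -- `Gbar` is obtained from `G` by splitting `v` into the two adjacent nodes
    -- `none` (playing the role of `v₁`) and `some v` (playing the role of `v₂`);
    -- all other vertices `u ≠ v` are represented by `some u`.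
    (Gbar : SimpleGraph (Option V)) [DecidableRel Gbar.Adj]
    (h12 : Gbar.Adj none (some v))
    (hold : ∀ u w : V, u ≠ v → w ≠ v → (Gbar.Adj (some u) (some w) ↔ G.Adj u w))
    (hnone : ∀ w : V, w ≠ v → ¬(Gbar.Adj none (some w) ∧ Gbar.Adj (some v) (some w)))
    (hdistrib : ∀ w : V, w ≠ v →
      ((Gbar.Adj none (some w) ∨ Gbar.Adj (some v) (some w)) ↔ G.Adj v w))
    -- `ω` is the maximum weight (with respect to the weights `a ∘ φ`, where
    -- `φ = Sym2.map (·.getD v)` reinterprets edges of `Gbar` as edges of `G`) of a bond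
    -- of `Gbar - v₁v₂` separating `v₁` from `v₂`.
    (ω : ℝ)
    (hω : IsGreatest {t : ℝ | ∃ S : Set (Option V), none ∈ S ∧ some v ∉ S ∧
        IsBond (Gbar.deleteEdges {s(none, some v)})
          (cut (Gbar.deleteEdges {s(none, some v)}) S) ∧
        t = dot a (indVec G (Sym2.map (fun x => x.getD v) ''
              cut (Gbar.deleteEdges {s(none, some v)}) S))} ω)
    (abar : ↥Gbar.edgeSet → ℝ)
    (habar_new : abar ⟨s(none, some v), Gbar.mem_edgeSet.mpr h12⟩ = b - ω)
    (habar_old : ∀ e : ↥Gbar.edgeSet, (e : Sym2 (Option V)) ≠ s(none, some v) →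
      ∀ hf : Sym2.map (fun x => x.getD v) (e : Sym2 (Option V)) ∈ G.edgeSet,
        abar e = a ⟨Sym2.map (fun x => x.getD v) (e : Sym2 (Option V)), hf⟩) :
    IsFacet (bondPolytope Gbar) abar b := by
  have h : IsSplitting G v Gbar := ⟨h12, hold, hnone, hdistrib⟩
  obtain ⟨ha, hvalid, ⟨x₀, hx₀, hx₀b⟩, hdim⟩ := hfacet
  have hG' := cutConnected_univ hG.preconnected
  have hGbar : CutConnected Gbar Set.univ := by
    simpa using h.cutConnected_preimage.2 hG'
  have hlift : ∀ f, abar (h.lift f) = a f := fun f => by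
    rw [habar_old _ (h.lift_ne f) (by rw [h.map_lift]; exact f.2)]
    exact congrArg a (Subtype.ext (h.map_lift f))
  have hnew : abar h.newEdge = b - ω := habar_new
  have hext : ∀ x, dot abar (h.extend x) = dot a x := fun x => by
    simp [h.dot_eq hlift, h.extend_newEdge, h.extend_lift]
  have habar : abar ≠ 0 := fun h0 => ha (funext fun f => by simp [← hlift, h0])
  have hsep : ∀ S : Set (Option V), none ∈ S → some v ∉ S →
      dot abar (indVec Gbar (cut Gbar S)) = b - ω + dot a (indVec G (Sym2.map (fun x => x.getD v) ''
        cut (Gbar.deleteEdges {s(none, some v)}) S)) := fun S hn hv => by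
    rw [h.dot_eq hlift, hnew, h.newEdge_mem_cut hn hv, h.indVec_cut_lift, mul_one]
  have hsepvalid : ∀ S : Set (Option V), none ∈ S → some v ∉ S → CutConnected Gbar S →
      CutConnected Gbar Sᶜ → dot abar (indVec Gbar (cut Gbar S)) ≤ b := fun S hn hv h₁ h₂ => by
    have hle := hω.2 ⟨S, hn, hv, isBond_cut
      ((cutConnected_deleteEdges_iff fun hS => hv hS.2).2 h₁)
      ((cutConnected_deleteEdges_iff fun hS : none ∈ Sᶜ ∧ _ => hS.1 hn).2 h₂), rfl⟩
    rw [hsep S hn hv]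
    linarith
  have hvalid' : ∀ y ∈ bondPolytope Gbar, dot abar y ≤ b := by
    refine dot_le_of_mem_convexHull ?_
    rintro _ ⟨D, hD, rfl⟩
    obtain ⟨S, rfl, h₁, h₂⟩ := hD.exists_cutConnected
    by_cases hn : none ∈ S <;> by_cases hv : some v ∈ S
    rotate_left
    · exact hsepvalid S hn hv h₁ h₂
    · rw [← cut_compl]
      exact hsepvalid Sᶜ hn (not_not.2 hv) h₂ (by rwa [compl_compl])
    all_goals
      have hS : S = (fun x => x.getD v) ⁻¹' (some ⁻¹' S) := by
        ext (_ | x) <;> simp [hn, hv]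
      rw [hS] at h₁ h₂ ⊢
      rw [← Set.preimage_compl] at h₂
      rw [← h.extend_indVec_cut, hext]
      exact hvalid _ (subset_convexHull ℝ _ ⟨_, isBond_cut (h.cutConnected_preimage.1 h₁)
        (h.cutConnected_preimage.1 h₂), rfl⟩)
  obtain ⟨⟨S, hn, hv, hb, hSω⟩, -⟩ := hω
  obtain ⟨R, hnR, hvR, hcut, h₁, h₂⟩ := exists_separating_of_isBond_cut hn hv hb
  rw [cutConnected_deleteEdges_iff fun hR => hvR hR.2] at h₁
  rw [cutConnected_deleteEdges_iff fun hR : none ∈ Rᶜ ∧ _ => hR.1 hnR] at h₂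
  have hmemR : indVec Gbar (cut Gbar R) ∈ {y ∈ bondPolytope Gbar | dot abar y = b} :=
    ⟨subset_convexHull ℝ _ ⟨_, isBond_cut h₁ h₂, rfl⟩, by
      rw [hsep R hnR hvR, hcut, ← hSω]; ring⟩
  have hmem₀ : h.extend x₀ ∈ {y ∈ bondPolytope Gbar | dot abar y = b} :=
    ⟨h.extend_mem_bondPolytope hx₀, by rw [hext, hx₀b]⟩
  refine ⟨habar, hvalid', ⟨_, hmemR⟩, ?_⟩
  have hlt : (vectorSpan ℝ {x ∈ bondPolytope G | dot a x = b}).map h.extend <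
      vectorSpan ℝ {y ∈ bondPolytope Gbar | dot abar y = b} := by
    refine lt_of_le_of_ne ?_ fun heq => ?_
    · rw [vectorSpan_def, Submodule.map_span, Submodule.span_le]
      rintro _ ⟨_, ⟨x, hx, y, hy, rfl⟩, rfl⟩
      simp only [vsub_eq_sub, map_sub]
      exact vsub_mem_vectorSpan ℝ ⟨h.extend_mem_bondPolytope hx.1, by rw [hext, hx.2]⟩
        ⟨h.extend_mem_bondPolytope hy.1, by rw [hext, hy.2]⟩
    · obtain ⟨z, -, hz⟩ := heq ▸ vsub_mem_vectorSpan ℝ hmemR hmem₀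
      have := congrFun hz h.newEdge
      simp [h.extend_newEdge, h.newEdge_mem_cut hnR hvR] at this
  have hlower := Submodule.finrank_lt_finrank_of_lt hlt
  rw [← (Submodule.equivMapOfInjective _ h.extend_injective _).finrank_eq] at hlower
  have hupper := affDim_face_lt (bondPolytope Gbar) habar b
  have hcard : Fintype.card Gbar.edgeSet = Fintype.card G.edgeSet + 1 := by
    have := h.sum_edgeSet (fun _ => 1)
    simp only [Finset.sum_const, Finset.card_univ, nsmul_eq_mul, mul_one] at this
    rw [add_comm] at this
    exact_mod_cast this
  rw [affDim_bondPolytope hG'] at hdim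
  rw [affDim_bondPolytope hGbar]
  unfold affDim at *
  omega

end BondPolytope
end

section
/- Let G be a finite simple connected graph and let C be a cycle in G. Then every bond δ of G satisfies |δ ∩ E(C)| ≤ 2 if and only if C is non-interleaved. -/
open Finset

namespace BondPolytope

variable {V : Type*}

/-- The cycle given by the closed walk `c` is interleaved: there are four vertices
appearing in this cyclic order along `c` that are connected crosswise by two
vertex-disjoint paths in `G - E(c)`. -/
def IsInterleaved (G : SimpleGraph V) {v : V} (c : G.Walk v v) : Prop :=
  ∃ i₁ i₂ i₃ i₄ : ℕ, i₁ < i₂ ∧ i₂ < i₃ ∧ i₃ < i₄ ∧ i₄ < c.length ∧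
    ∃ (q₁ : (G.deleteEdges {e | e ∈ c.edges}).Walk (c.getVert i₁) (c.getVert i₃))
      (q₂ : (G.deleteEdges {e | e ∈ c.edges}).Walk (c.getVert i₂) (c.getVert i₄)),
      q₁.IsPath ∧ q₂.IsPath ∧ ∀ x ∈ q₁.support, x ∉ q₂.support

/-- A property that is stable under adjacency inside `S` holds throughout `S` as soon as it
holds at one vertex, if `S` induces a preconnected graph. -/
lemma forall_of_induce_preconnected {G : SimpleGraph V} {S : Set V}
    (hS : (G.induce S).Preconnected) {P : V → Prop} {a b : V} (ha : a ∈ S) (hb : b ∈ S)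
    (hP : ∀ u ∈ S, ∀ w ∈ S, G.Adj u w → P u → P w) (h : P a) : P b := by
  obtain ⟨p⟩ := hS ⟨a, ha⟩ ⟨b, hb⟩
  suffices H : ∀ (x y : S), (G.induce S).Walk x y → P x → P y from H _ _ p h
  intro x y q
  induction q with
  | nil => exact id
  | cons hadj _ ih => exact fun hx => ih (hP _ (Subtype.coe_prop _) _ (Subtype.coe_prop _) hadj hx)

/-- A set all of whose vertices are joined inside it to a fixed vertex induces a preconnected
graph. -/
lemma induce_preconnected_of_walks {G : SimpleGraph V} {S : Set V} {a : V}
    (h : ∀ u ∈ S, ∃ p : G.Walk u a, ∀ x ∈ p.support, x ∈ S) : (G.induce S).Preconnected := by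
  rintro ⟨u, hu⟩ ⟨w, hw⟩
  obtain ⟨p, hp⟩ := h u hu
  obtain ⟨q, hq⟩ := h w hw
  exact (p.induce S hp).reachable.trans (q.induce S hq).reachable.symm

/-- Disjoint walks in a connected graph lie on the two sides of a bond. -/
lemma exists_bond_separating {G : SimpleGraph V} (hG : G.Connected) {a a' b b' : V}
    (p : G.Walk a a') (q : G.Walk b b') (hpq : ∀ x ∈ p.support, x ∉ q.support) :
    ∃ S : Set V, (G.induce S).Preconnected ∧ (G.induce Sᶜ).Preconnected ∧
      a ∈ S ∧ a' ∈ S ∧ b ∉ S ∧ b' ∉ S := by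
  classical
  let S : Set V := {u | ∃ r : G.Walk u a, ∀ x ∈ r.support, x ∉ q.support}
  have hdisj : ∀ u ∈ q.support, u ∉ S := fun u hu ⟨r, hr⟩ => hr u r.start_mem_support hu
  refine ⟨S, ?_, ?_, ?_, ?_, hdisj _ q.start_mem_support, hdisj _ q.end_mem_support⟩
  · refine induce_preconnected_of_walks (a := a) fun u ⟨r, hr⟩ => ⟨r, fun x hx => ?_⟩
    exact ⟨r.dropUntil x hx, fun y hy => hr y (r.support_dropUntil_subset_support hx hy)⟩
  · refine induce_preconnected_of_walks (a := b') fun u hu => ?_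
    obtain ⟨r⟩ := hG.preconnected u b'
    suffices H : ∀ (x y : V), G.Walk x y → y = b' → x ∉ S →
        ∃ p : G.Walk x b', ∀ z ∈ p.support, z ∈ Sᶜ from H _ _ r rfl hu
    intro x y r
    induction r with
    | nil => rintro rfl hx; exact ⟨.nil, by simpa using hx⟩
    | @cons x w y hadj r ih =>
      intro hy hx
      by_cases hxq : x ∈ q.support
      · exact ⟨q.dropUntil x hxq,
          fun z hz => hdisj z (q.support_dropUntil_subset_support hxq hz)⟩
      · have hw : w ∉ S := fun ⟨t, ht⟩ => hx ⟨.cons hadj t, by simpa [hxq] using ht⟩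
        obtain ⟨t, ht⟩ := ih hy hw
        exact ⟨.cons hadj t, by simpa using ⟨hx, ht⟩⟩
  · exact ⟨.nil, by simpa using hpq a p.start_mem_support⟩
  · exact ⟨p.reverse, by simpa using hpq⟩

/-- If a connected side `S` meets a cycle strictly between two positions whose vertices are not
in `S`, and also outside of them, then both parts are joined inside `S` off the cycle. -/
lemma exists_walk_off_cycle {G : SimpleGraph V} {v : V} {c : G.Walk v v} (hc : c.IsCycle)
    {S : Set V} (hS : (G.induce S).Preconnected) {p q i j : ℕ} (hq : q < c.length)
    (hpS : c.getVert p ∉ S) (hqS : c.getVert q ∉ S)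
    (hpi : p < i) (hiq : i < q) (hiS : c.getVert i ∈ S)
    (hj : j < p ∨ q < j) (hjn : j < c.length) (hjS : c.getVert j ∈ S) :
    ∃ k l : ℕ, p < k ∧ k < q ∧ (l < p ∨ q < l) ∧ l < c.length ∧
      c.getVert k ∈ S ∧ c.getVert l ∈ S ∧
      ∃ w : (G.deleteEdges {e | e ∈ c.edges}).Walk (c.getVert k) (c.getVert l),
        ∀ x ∈ w.support, x ∈ S := by
  have inj : ∀ {m n : ℕ}, m < c.length → n < c.length → c.getVert m = c.getVert n → m = n :=
    fun hm hn h => hc.getVert_injOn' (by simp; omega) (by simp; omega) h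
  by_contra hcon
  suffices H : ∃ k, p < k ∧ k < q ∧ c.getVert k ∈ S ∧
      ∃ w : (G.deleteEdges {e | e ∈ c.edges}).Walk (c.getVert k) (c.getVert j),
        ∀ x ∈ w.support, x ∈ S by
    obtain ⟨k, h₁, h₂, h₃, w, hw⟩ := H
    exact hcon ⟨k, j, h₁, h₂, hj, hjn, h₃, hjS, w, hw⟩
  refine forall_of_induce_preconnected hS (P := fun u => ∃ k, p < k ∧ k < q ∧ c.getVert k ∈ S ∧
      ∃ w : (G.deleteEdges {e | e ∈ c.edges}).Walk (c.getVert k) u, ∀ x ∈ w.support, x ∈ S)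
    hiS hjS ?_ ⟨i, hpi, hiq, hiS, .nil, by simpa using hiS⟩
  rintro u hu w hw hadj ⟨k, hpk, hkq, hkS, r, hr⟩
  by_cases he : s(u, w) ∈ c.edges
  · have hin : ∀ l < c.length, c.getVert l = u → p < l ∧ l < q := by
      rintro l hl rfl
      by_contra hpl
      have : l ≠ p := by rintro rfl; exact hpS hu
      have : l ≠ q := by rintro rfl; exact hqS hu
      exact hcon ⟨k, l, hpk, hkq, by omega, hl, hkS, hu, r, hr⟩
    suffices H : ∃ l, p < l ∧ l < q ∧ c.getVert l = w by
      obtain ⟨l, hpl, hlq, rfl⟩ := H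
      exact ⟨l, hpl, hlq, hw, .nil, by simpa using hw⟩
    obtain ⟨m, hm, hm'⟩ := c.mk_mem_edges_iff_exists.1 he
    rcases Sym2.eq_iff.1 hm' with ⟨rfl, rfl⟩ | ⟨rfl, rfl⟩
    · obtain ⟨h₁, h₂⟩ := hin m hm rfl
      have : m + 1 ≠ q := by rintro rfl; exact hqS hw
      exact ⟨m + 1, by omega, by omega, rfl⟩
    · have hm1 : m + 1 < c.length := by
        by_contra hlen
        have hlen : m + 1 = c.length := by omega
        have := hin 0 (by omega) (by rw [hlen]; simp)
        omega
      obtain ⟨h₁, h₂⟩ := hin (m + 1) hm1 rfl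
      have : m ≠ p := by rintro rfl; exact hpS hw
      exact ⟨m, by omega, by omega, rfl⟩
  · have hadj' : (G.deleteEdges {e | e ∈ c.edges}).Adj u w := by simpa using ⟨hadj, he⟩
    refine ⟨k, hpk, hkq, hkS, r.concat hadj', fun x hx => ?_⟩
    rw [SimpleGraph.Walk.support_concat, List.mem_append, List.mem_singleton] at hx
    rcases hx with hx | rfl
    exacts [hr x hx, hw]

/-- Disjoint walks off the cycle joining crossing pairs of vertices make it interleaved. -/
lemma isInterleaved_of_walks {G : SimpleGraph V} {v : V} {c : G.Walk v v} {i₁ i₂ i₃ i₄ : ℕ}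
    (h₁₂ : i₁ < i₂) (h₂₃ : i₂ < i₃) (h₃₄ : i₃ < i₄) (h₄ : i₄ < c.length) {S T : Set V}
    (hST : Disjoint S T)
    (h₁ : ∃ w : (G.deleteEdges {e | e ∈ c.edges}).Walk (c.getVert i₁) (c.getVert i₃),
      ∀ x ∈ w.support, x ∈ S)
    (h₂ : ∃ w : (G.deleteEdges {e | e ∈ c.edges}).Walk (c.getVert i₂) (c.getVert i₄),
      ∀ x ∈ w.support, x ∈ T) : IsInterleaved G c := by
  classical
  obtain ⟨w₁, hw₁⟩ := h₁
  obtain ⟨w₂, hw₂⟩ := h₂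
  exact ⟨i₁, i₂, i₃, i₄, h₁₂, h₂₃, h₃₄, h₄, w₁.bypass, w₂.bypass, w₁.bypass_isPath,
    w₂.bypass_isPath, fun x hx hx' => Set.disjoint_left.1 hST
      (hw₁ x (w₁.support_bypass_subset_support hx)) (hw₂ x (w₂.support_bypass_subset_support hx'))⟩

/-- A cycle whose vertices alternate at least four times between the sides of a bond is
interleaved. -/
lemma isInterleaved_of_alternating {G : SimpleGraph V} {v : V} {c : G.Walk v v} (hc : c.IsCycle)
    {S : Set V} (hS : (G.induce S).Preconnected) (hS' : (G.induce Sᶜ).Preconnected)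
    {i₁ i₂ i₃ i₄ : ℕ} (h₁₂ : i₁ < i₂) (h₂₃ : i₂ < i₃) (h₃₄ : i₃ < i₄) (h₄ : i₄ < c.length)
    (h₁S : c.getVert i₁ ∈ S) (h₂S : c.getVert i₂ ∉ S) (h₃S : c.getVert i₃ ∈ S)
    (h₄S : c.getVert i₄ ∉ S) : IsInterleaved G c := by
  obtain ⟨k, l, h₂k, hk₄, hl, hln, hkS, hlS, w, hw⟩ := exists_walk_off_cycle hc hS h₄ h₂S h₄S
    h₂₃ h₃₄ h₃S (j := i₁) (by omega) (by omega) h₁S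
  have hw' : ∀ x ∈ w.reverse.support, x ∈ S := by simpa using hw
  rcases hl with hl | hl
  · obtain ⟨m, n, h₁, h₂, hn, hnn, -, -, r, hr⟩ := exists_walk_off_cycle hc hS' (p := l) (q := k)
      (i := i₂) (j := i₄) (by omega) (by simpa) (by simpa) hl h₂k h₂S (by omega) h₄ h₄S
    rcases hn with hn | hn
    · exact isInterleaved_of_walks hn h₁ h₂ (by omega) disjoint_compl_left
        ⟨r.reverse, by simpa using hr⟩ ⟨w.reverse, hw'⟩
    · exact isInterleaved_of_walks h₁ h₂ hn hnn disjoint_compl_right ⟨w.reverse, hw'⟩ ⟨r, hr⟩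
  · obtain ⟨m, n, h₁, h₂, hn, hnn, -, -, r, hr⟩ := exists_walk_off_cycle hc hS' (p := k) (q := l)
      (i := i₄) (j := i₂) (by omega) (by simpa) (by simpa) hk₄ hl h₄S (by omega) (by omega) h₂S
    rcases hn with hn | hn
    · exact isInterleaved_of_walks hn h₁ h₂ (by omega) disjoint_compl_left
        ⟨r.reverse, by simpa using hr⟩ ⟨w, hw⟩
    · exact isInterleaved_of_walks h₁ h₂ hn hnn disjoint_compl_right ⟨w, hw⟩ ⟨r, hr⟩

/-- A cyclic sequence with three changes alternates at four positions. -/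
lemma exists_alternating {f : ℕ → Prop} {n j₁ j₂ j₃ : ℕ} (hf : f n ↔ f 0) (h₁₂ : j₁ < j₂)
    (h₂₃ : j₂ < j₃) (h₃ : j₃ < n) (hj₁ : ¬(f j₁ ↔ f (j₁ + 1))) (hj₂ : ¬(f j₂ ↔ f (j₂ + 1)))
    (hj₃ : ¬(f j₃ ↔ f (j₃ + 1))) :
    ∃ i₁ i₂ i₃ i₄, i₁ < i₂ ∧ i₂ < i₃ ∧ i₃ < i₄ ∧ i₄ < n ∧
      ¬(f i₁ ↔ f i₂) ∧ ¬(f i₂ ↔ f i₃) ∧ ¬(f i₃ ↔ f i₄) := by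
  have hpos : ∀ j, ¬(f j ↔ f 0) → 0 < j := fun j h =>
    Nat.pos_of_ne_zero fun hj => h (hj ▸ Iff.rfl)
  by_cases h₁ : f j₂ ↔ f (j₁ + 1)
  · by_cases h₂ : f j₃ ↔ f (j₂ + 1)
    · by_cases hn : j₃ + 1 = n
      · rw [hn] at hj₃
        exact ⟨0, j₁, j₂, j₃, hpos _ (by grind), h₁₂, h₂₃, h₃, by grind, by grind, by grind⟩
      · exact ⟨j₁, j₂, j₃, j₃ + 1, h₁₂, h₂₃, by omega, by omega, by grind, by grind, by grind⟩
    · have hne : j₂ + 1 ≠ j₃ := by rintro rfl; exact h₂ Iff.rfl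
      by_cases hn : j₃ + 1 = n
      · rw [hn] at hj₃
        exact ⟨0, j₂, j₂ + 1, j₃, hpos _ (by grind), by omega, by omega, h₃, by grind, by grind,
          by grind⟩
      · exact ⟨j₂, j₂ + 1, j₃, j₃ + 1, by omega, by omega, by omega, by omega, by grind, by grind,
          by grind⟩
  · have hne : j₁ + 1 ≠ j₂ := by rintro rfl; exact h₁ Iff.rfl
    exact ⟨j₁, j₁ + 1, j₂, j₂ + 1, by omega, by omega, by omega, by omega, by grind, by grind,
      by grind⟩

/-- A sequence taking different truth values at two positions changes in between. -/
lemma exists_change {f : ℕ → Prop} {a b : ℕ} (hab : a < b) (h : ¬(f a ↔ f b)) :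
    ∃ j, a ≤ j ∧ j < b ∧ ¬(f j ↔ f (j + 1)) := by
  by_contra! hcon
  have H : ∀ m, a ≤ m → m ≤ b → (f a ↔ f m) := fun m ham =>
    Nat.le_induction (fun _ => Iff.rfl)
      (fun k hk ih hkb => (ih (by omega)).trans (hcon k hk (by omega))) m ham
  exact h (H b hab.le le_rfl)

/-- The `j`-th edge of a walk lies in a cut iff its endpoints are on different sides. -/
lemma getVert_mem_cut_iff {G : SimpleGraph V} {u v : V} {c : G.Walk u v} {S : Set V} {j : ℕ}
    (hj : j < c.length) : s(c.getVert j, c.getVert (j + 1)) ∈ cut G S ↔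
      ¬(c.getVert j ∈ S ↔ c.getVert (j + 1) ∈ S) := by
  constructor
  · rintro ⟨-, a, b, hab, ha, hb⟩
    rcases Sym2.eq_iff.1 hab with ⟨h₁, h₂⟩ | ⟨h₁, h₂⟩ <;> rw [h₁, h₂] <;> tauto
  · intro h
    refine ⟨c.adj_getVert_succ hj, ?_⟩
    by_cases h₁ : c.getVert j ∈ S
    · exact ⟨_, _, rfl, h₁, by tauto⟩
    · exact ⟨_, _, Sym2.eq_swap, by tauto, h₁⟩

theorem noninterleaved_iff_bonds_meet_in_le_two {V : Type*} [Fintype V] [DecidableEq V]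
    (G : SimpleGraph V) [DecidableRel G.Adj] (hG : G.Connected)
    (v : V) (c : G.Walk v v) (hc : c.IsCycle) :
    (∀ D : Set (Sym2 V), IsBond G D → (D ∩ {e | e ∈ c.edges}).ncard ≤ 2) ↔
      ¬ IsInterleaved G c := by
  classical
  have hedge : ∀ {j}, j < c.length → s(c.getVert j, c.getVert (j + 1)) ∈ c.edges :=
    fun hj => c.mk_mem_edges_iff_exists.2 ⟨_, hj, rfl⟩
  have hinj : ∀ {j k}, j < k → k + 1 < c.length →
      s(c.getVert j, c.getVert (j + 1)) ≠ s(c.getVert k, c.getVert (k + 1)) := by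
    intro j k hjk hk h
    rcases Sym2.eq_iff.1 h with ⟨h₁, -⟩ | ⟨h₁, -⟩ <;>
    · have := hc.getVert_injOn' (by simp; omega) (by simp; omega) h₁
      omega
  constructor
  · rintro h ⟨i₁, i₂, i₃, i₄, h₁₂, h₂₃, h₃₄, h₄, q₁, q₂, -, -, hq⟩
    have hle := G.deleteEdges_le {e | e ∈ c.edges}
    obtain ⟨S, hS, hS', h₁S, h₃S, h₂S, h₄S⟩ := exists_bond_separating hG (q₁.mapLe hle)
      (q₂.mapLe hle) (by simpa using hq)
    obtain ⟨j₁, -, hj₁, hf₁⟩ := exists_change (f := fun i => c.getVert i ∈ S) h₁₂ (by tauto)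
    obtain ⟨j₂, hj₂, hj₂', hf₂⟩ := exists_change (f := fun i => c.getVert i ∈ S) h₂₃ (by tauto)
    obtain ⟨j₃, hj₃, hj₃', hf₃⟩ := exists_change (f := fun i => c.getVert i ∈ S) h₃₄ (by tauto)
    refine (h _ ⟨S, rfl, hS, hS'⟩).not_gt ((Set.two_lt_ncard_iff).2 ⟨_, _, _,
      ⟨(getVert_mem_cut_iff ?_).2 hf₁, hedge ?_⟩, ⟨(getVert_mem_cut_iff ?_).2 hf₂, hedge ?_⟩,
      ⟨(getVert_mem_cut_iff ?_).2 hf₃, hedge ?_⟩, hinj ?_ ?_, hinj ?_ ?_, hinj ?_ ?_⟩) <;> omega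
  · rintro hni D ⟨S, rfl, hS, hS'⟩
    let J : Finset ℕ := {j ∈ range c.length | ¬(c.getVert j ∈ S ↔ c.getVert (j + 1) ∈ S)}
    have hsub : cut G S ∩ {e | e ∈ c.edges} ⊆
        J.image fun j => s(c.getVert j, c.getVert (j + 1)) := by
      rintro e ⟨he, hec⟩
      induction e with | _ a b
      obtain ⟨j, hj, hje⟩ := c.mk_mem_edges_iff_exists.1 hec
      rw [← hje] at he ⊢
      exact mem_coe.2 (mem_image_of_mem _
        (mem_filter.2 ⟨mem_range.2 hj, (getVert_mem_cut_iff hj).1 he⟩))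
    refine (Set.ncard_le_ncard hsub).trans ?_
    rw [Set.ncard_coe_finset]
    refine card_image_le.trans ?_
    by_contra! hJ
    obtain ⟨j₁, j₂, j₃, h₁₂, h₂₃, hj₁, hj₂, hj₃⟩ :
        ∃ j₁ j₂ j₃, j₁ < j₂ ∧ j₂ < j₃ ∧ j₁ ∈ J ∧ j₂ ∈ J ∧ j₃ ∈ J := by
      let g := J.orderEmbOfCardLe hJ
      exact ⟨g 0, g 1, g 2, g.strictMono (by decide), g.strictMono (by decide),
        J.orderEmbOfCardLe_mem hJ _, J.orderEmbOfCardLe_mem hJ _, J.orderEmbOfCardLe_mem hJ _⟩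
    simp only [J, mem_filter, mem_range] at hj₁ hj₂ hj₃
    obtain ⟨i₁, i₂, i₃, i₄, hi₁₂, hi₂₃, hi₃₄, hi₄, hf₁, hf₂, hf₃⟩ :=
      exists_alternating (f := fun i => c.getVert i ∈ S) (n := c.length) (by simp) h₁₂ h₂₃
        hj₃.1 hj₁.2 hj₂.2 hj₃.2
    by_cases hi : c.getVert i₁ ∈ S
    · exact hni (isInterleaved_of_alternating hc hS hS' hi₁₂ hi₂₃ hi₃₄ hi₄ hi (by tauto)
        (by tauto) (by tauto))
    · refine hni (isInterleaved_of_alternating hc hS' (by rwa [compl_compl]) hi₁₂ hi₂₃ hi₃₄ hi₄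
        hi ?_ ?_ ?_) <;> simp only [Set.mem_compl_iff] <;> tauto

end BondPolytope
end

section
/- Let G be a 3-connected finite simple graph with vertex set V and edge set E, let C be a cycle in G, and let f = pq ∈ E ∖ E(C). Then there exists S ⊆ V ∖ {p, q} such that δ(S), δ(S ∪ {p}), δ(S ∪ {q}), and δ(S ∪ {p, q}) are all bonds of G, each of which contains exactly two edges of C. -/
open Finset

namespace BondPolytope

variable {V : Type*}

/-- `G` is 3-connected: it has at least 4 vertices and deleting any at most 2 vertices
leaves it connected. -/
def ThreeConnected {V : Type*} [Fintype V] (G : SimpleGraph V) : Prop :=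
  4 ≤ Fintype.card V ∧ ∀ W : Set V, W.ncard ≤ 2 → (G.induce (Wᶜ : Set V)).Connected

/-- `v` can be reached from `u` by a walk of `G` all of whose edges have both ends in `M`. -/
def Reach (G : SimpleGraph V) (M : Set V) (u v : V) : Prop :=
  Relation.ReflTransGen (fun a b => G.Adj a b ∧ a ∈ M ∧ b ∈ M) u v

/-- The set `P` induces a connected (possibly empty) subgraph of `G`. -/
def Conn (G : SimpleGraph V) (P : Set V) : Prop :=
  ∀ u ∈ P, ∀ v ∈ P, Reach G P u v

/-- `S` meets all walks of `G` between `A` and `B`. -/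
def Separates (G : SimpleGraph V) (A B S : Set V) : Prop :=
  ∀ a ∈ A, a ∉ S → ∀ b ∈ B, b ∉ S → ¬ Reach G Sᶜ a b

section Reach

variable {G H : SimpleGraph V} {M N P Q : Set V} {u v w x y : V}

lemma Reach.refl : Reach G M u u := Relation.ReflTransGen.refl

lemma Reach.trans (h : Reach G M u v) (h' : Reach G M v w) : Reach G M u w :=
  Relation.ReflTransGen.trans h h'

lemma Reach.tail (h : Reach G M u v) (ha : G.Adj v w) (hv : v ∈ M) (hw : w ∈ M) :
    Reach G M u w :=
  Relation.ReflTransGen.tail h ⟨ha, hv, hw⟩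

lemma Reach.head (ha : G.Adj u v) (hu : u ∈ M) (hv : v ∈ M) (h : Reach G M v w) :
    Reach G M u w :=
  Relation.ReflTransGen.head ⟨ha, hu, hv⟩ h

lemma Reach.symm (h : Reach G M u v) : Reach G M v u := by
  induction h with
  | refl => exact .refl
  | tail _ h ih => exact .head h.1.symm h.2.2 h.2.1 ih

lemma Reach.mono' (h : Reach G M u v)
    (hGH : ∀ a ∈ M, ∀ b ∈ M, G.Adj a b → H.Adj a b ∧ a ∈ N ∧ b ∈ N) : Reach H N u v := by
  induction h with
  | refl => exact .refl
  | tail _ h ih =>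
    obtain ⟨h1, h2, h3⟩ := hGH _ h.2.1 _ h.2.2 h.1
    exact ih.tail h1 h2 h3

lemma Reach.mono (h : Reach G M u v) (hMN : M ⊆ N) : Reach G N u v :=
  h.mono' fun _ ha _ hb hab => ⟨hab, hMN ha, hMN hb⟩

lemma Reach.mem (h : Reach G M u v) (hu : u ∈ M) : v ∈ M := by
  cases h with
  | refl => exact hu
  | tail _ h => exact h.2.2

lemma Reach.mem_left (h : Reach G M u v) (hv : v ∈ M) : u ∈ M := h.symm.mem hv

/-- A walk that leaves the set `D` has an edge leaving `D`. -/
lemma Reach.exists_leaving {D : Set V} (h : Reach G M u v) (hu : u ∈ D) (hv : v ∉ D) :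
    ∃ a ∈ D, ∃ b, b ∉ D ∧ G.Adj a b ∧ a ∈ M ∧ b ∈ M := by
  induction h with
  | refl => exact absurd hu hv
  | @tail b c _ h ih =>
    by_cases hb : b ∈ D
    · exact ⟨b, hb, c, hv, h⟩
    · exact ih hb

/-- The part of a walk after its last vertex in `Z`. -/
lemma Reach.exists_last_exit {Z : Set V} (h : Reach G M u v) (hu : u ∈ Z) (hv : v ∉ Z) :
    ∃ z ∈ Z, ∃ a, a ∉ Z ∧ G.Adj z a ∧ a ∈ M ∧ Reach G (M \ Z) a v := by
  suffices H : Reach G (M \ Z) u v ∧ u ∉ Z ∨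
      ∃ z ∈ Z, ∃ a, a ∉ Z ∧ G.Adj z a ∧ a ∈ M ∧ Reach G (M \ Z) a v by
    rcases H with H | H
    · exact absurd hu H.2
    · exact H
  clear hu
  induction h using Relation.ReflTransGen.head_induction_on with
  | refl => exact .inl ⟨.refl, hv⟩
  | @head a b h _ ih =>
    rcases ih with ⟨ih, hb⟩ | ih
    · by_cases ha : a ∈ Z
      · exact .inr ⟨a, ha, b, hb, h.1, h.2.2, ih⟩
      · exact .inl ⟨.head h.1 ⟨h.2.1, ha⟩ ⟨h.2.2, hb⟩ ih, ha⟩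
    · exact .inr ih

lemma conn_of_base (h : ∀ v ∈ P, Reach G P x v) : Conn G P :=
  fun u hu v hv => (h u hu).symm.trans (h v hv)

lemma conn_singleton : Conn G {x} := by
  intro u hu v hv
  obtain rfl : u = x := hu
  obtain rfl : v = u := hv
  exact .refl

lemma Conn.mono_graph (h : Conn G P) (hGH : G ≤ H) : Conn H P :=
  fun u hu v hv => (h u hu v hv).mono' fun _ ha _ hb hab => ⟨hGH hab, ha, hb⟩

lemma Conn.union (hP : Conn G P) (hQ : Conn G Q) (hx : x ∈ P) (hy : y ∈ Q)
    (hxy : x = y ∨ G.Adj x y) : Conn G (P ∪ Q) := by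
  have key : Reach G (P ∪ Q) x y := by
    rcases hxy with rfl | hxy
    · exact .refl
    · exact Reach.refl.tail hxy (.inl hx) (.inr hy)
  refine conn_of_base (x := x) fun v hv => ?_
  rcases hv with hv | hv
  · exact (hP x hx v hv).mono Set.subset_union_left
  · exact key.trans ((hQ y hy v hv).mono Set.subset_union_right)

lemma conn_insert (hP : Conn G P) (hy : y ∈ P) (hxy : G.Adj x y) : Conn G (insert x P) :=
  conn_singleton.union hP (Set.mem_singleton x) hy (.inr hxy)

lemma reach_component (h : Reach G M x v) : Reach G {u | Reach G M x u} x v := by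
  induction h with
  | refl => exact .refl
  | tail h h' ih => exact ih.tail h'.1 h (Reach.tail h h'.1 h'.2.1 h'.2.2)

lemma conn_component : Conn G {u | Reach G M x u} :=
  conn_of_base fun _ h => reach_component h

/-- In a connected set, the complement of a component of the complement of a connected
subset is connected. -/
lemma conn_diff_component (hM : Conn G M) (hPM : P ⊆ M) (hP : Conn G P) (hx : x ∈ P)
    (hy : y ∈ M \ P) : Conn G (M \ {u | Reach G (M \ P) y u}) := by
  have hPB : P ⊆ M \ {u | Reach G (M \ P) y u} :=
    fun u hu => ⟨hPM hu, fun h => (Reach.mem h hy).2 hu⟩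
  refine conn_of_base (x := x) fun v hv => Reach.symm ?_
  have hvx := hM v hv.1 x (hPM hx)
  induction hvx using Relation.ReflTransGen.head_induction_on with
  | refl => exact .refl
  | @head a b h _ ih =>
    by_cases ha : a ∈ P
    · exact (hP a ha x hx).mono hPB
    · have hb : b ∈ M \ {u | Reach G (M \ P) y u} := by
        refine ⟨h.2.2, fun hb => hv.2 ?_⟩
        have hb' : Reach G (M \ P) y b := hb
        exact hb'.tail h.1.symm (hb'.mem hy) ⟨h.2.1, ha⟩
      exact .head h.1 hv hb (ih hb)

/-- A connected set meeting `Y` contains, for each of its points `a`, a connected subset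
containing `a` with a unique point in `Y`. -/
lemma Conn.exists_trim {Y : Set V} (hP : Conn G P) (hx : x ∈ P) (hy : y ∈ P) (hyY : y ∈ Y) :
    ∃ P' ⊆ P, Conn G P' ∧ x ∈ P' ∧ ∃ z ∈ P', z ∈ Y ∧
      ∀ v ∈ P', v ≠ z → v ∉ Y ∧ x ∉ Y ∧ Reach G (P \ Y) x v := by
  by_cases hxY : x ∈ Y
  · refine ⟨{x}, by simpa, conn_singleton, rfl, x, rfl, hxY, fun v hv hne => absurd hv hne⟩
  · have hxR : x ∈ {u | Reach G (P \ Y) x u} := Reach.refl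
    have hyR : y ∉ {u | Reach G (P \ Y) x u} := fun h => (Reach.mem h ⟨hx, hxY⟩).2 hyY
    obtain ⟨a, ha, b, hb, hab, haP, hbP⟩ := (hP x hx y hy).exists_leaving hxR hyR
    have ha' : Reach G (P \ Y) x a := ha
    have haY := ha'.mem ⟨hx, hxY⟩
    have hbY : b ∈ Y := by
      by_contra h
      exact hb (ha'.tail hab haY ⟨hbP, h⟩)
    refine ⟨insert b {u | Reach G (P \ Y) x u}, ?_, conn_insert conn_component ha hab.symm,
      .inr hxR, b, .inl rfl, hbY, ?_⟩
    · rintro u (rfl | hu)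
      · exact hbP
      · exact (Reach.mem hu ⟨hx, hxY⟩).1
    · rintro v (rfl | hv) hne
      · exact absurd rfl hne
      · exact ⟨(Reach.mem hv ⟨hx, hxY⟩).2, hxY, hv⟩

end Reach

section Menger

variable {G G' : SimpleGraph V} {A B S : Set V} {x y : V}

lemma Separates.symm (h : Separates G A B S) : Separates G B A S :=
  fun b hb hbS a ha haS hba => h a ha haS b hb hbS hba.symm

/-- A walk either avoids the edge `xy`, or can be shortened to use it only once. -/
lemma Reach.deleteEdge {M : Set V} {a b : V}
    (hG' : ∀ u w, G.Adj u w → G'.Adj u w ∨ (u = x ∧ w = y) ∨ (u = y ∧ w = x))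
    (h : Reach G M a b) :
    Reach G' M a b ∨ (Reach G' M a x ∧ Reach G' M y b) ∨ (Reach G' M a y ∧ Reach G' M x b) := by
  induction h with
  | refl => exact .inl .refl
  | @tail b c _ h ih =>
    rcases hG' _ _ h.1 with h' | ⟨rfl, rfl⟩ | ⟨rfl, rfl⟩
    · rcases ih with ih | ih | ih
      · exact .inl (ih.tail h' h.2.1 h.2.2)
      · exact .inr (.inl ⟨ih.1, ih.2.tail h' h.2.1 h.2.2⟩)
      · exact .inr (.inr ⟨ih.1, ih.2.tail h' h.2.1 h.2.2⟩)
    · rcases ih with ih | ih | ih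
      · exact .inr (.inl ⟨ih, .refl⟩)
      · exact .inr (.inl ⟨ih.1, .refl⟩)
      · exact .inl ih.1
    · rcases ih with ih | ih | ih
      · exact .inr (.inr ⟨ih, .refl⟩)
      · exact .inl ih.1
      · exact .inr (.inr ⟨ih.1, .refl⟩)

/-- If `S` separates `A` from `B` after deleting an edge `xy`, and `y` is on the side of `B`,
then any set separating `A` from `S ∪ {x}` separates `A` from `B` in the original graph. -/
lemma Separates.of_insert {T : Set V} {b : V}
    (hG' : ∀ u w, G.Adj u w → G'.Adj u w ∨ (u = x ∧ w = y) ∨ (u = y ∧ w = x))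
    (hS : Separates G' A B S) (hb : b ∈ B) (hbS : b ∉ S) (hyb : Reach G' Sᶜ y b)
    (hT : Separates G' A (insert x S) T) : Separates G A B T := by
  intro a ha haT b' hb' hb'T hab
  have key : ∀ v, Reach G Tᶜ a v →
      v ∉ insert x S ∧ Reach G' (Tᶜ ∩ (insert x S)ᶜ) a v := by
    intro v hv
    induction hv with
    | refl => exact ⟨fun h => hT a ha haT a h haT .refl, .refl⟩
    | @tail v w _ h ih =>
      obtain ⟨hvS, hav⟩ := ih
      have hadj : G'.Adj v w := by
        rcases hG' _ _ h.1 with h' | ⟨rfl, rfl⟩ | ⟨rfl, rfl⟩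
        · exact h'
        · exact absurd (Set.mem_insert _ _) hvS
        · have hav' : Reach G' Sᶜ a v := hav.mono fun u hu hu' => hu.2 (.inr hu')
          have haS : a ∉ S := hav'.mem_left fun h => hvS (.inr h)
          exact absurd (hav'.trans hyb) (hS a ha haS b hb hbS)
      have hw : w ∉ insert x S := by
        intro hw
        exact hT a ha haT w hw h.2.2
          ((hav.mono Set.inter_subset_left).tail hadj h.2.1 h.2.2)
      exact ⟨hw, hav.tail hadj ⟨h.2.1, hvS⟩ ⟨h.2.2, hw⟩⟩
  obtain ⟨hbS', hab'⟩ := key b' hab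
  have hab'' : Reach G' Sᶜ a b' := hab'.mono fun u hu hu' => hu.2 (.inr hu')
  have hb'S : b' ∉ S := fun h => hbS' (.inr h)
  exact hS a ha (hab''.mem_left hb'S) b' hb' hb'S hab''

/-- A family of disjoint connected sets from `A` to a set `Y` of the same cardinality can be
indexed by `Y` and trimmed to meet `Y` only in the index. -/
lemma exists_indexed_linkage {ι : Type*} {Y : Finset V} {I : Finset ι} (hI : I.card = Y.card)
    {P : ι → Set V} (hP : ∀ i ∈ I, Conn G (P i) ∧ (P i ∩ A).Nonempty ∧ (P i ∩ ↑Y).Nonempty)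
    (hdisj : ∀ i ∈ I, ∀ j ∈ I, i ≠ j → Disjoint (P i) (P j)) :
    ∃ Q : V → Set V, (∀ i ∈ Y, Conn G (Q i) ∧ i ∈ Q i ∧ ∃ a ∈ Q i, a ∈ A ∧
        ∀ v ∈ Q i, v ≠ i → v ∉ Y ∧ a ∉ Y ∧ Reach G (↑Y)ᶜ a v) ∧
      ∀ i ∈ Y, ∀ j ∈ Y, i ≠ j → Disjoint (Q i) (Q j) := by
  have htrim : ∀ i ∈ I, ∃ (P' : Set V) (z : V), P' ⊆ P i ∧ Conn G P' ∧ z ∈ P' ∧ z ∈ Y ∧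
      ∃ a ∈ P', a ∈ A ∧ ∀ v ∈ P', v ≠ z → v ∉ Y ∧ a ∉ Y ∧ Reach G (↑Y)ᶜ a v := by
    intro i hi
    obtain ⟨hc, ⟨a, ha, haA⟩, ⟨y, hy, hyY⟩⟩ := hP i hi
    obtain ⟨P', hP'P, hc', haP', z, hz, hzY, h⟩ := hc.exists_trim ha hy hyY
    exact ⟨P', z, hP'P, hc', hz, hzY, a, haP', haA, fun v hv hne =>
      ⟨(h v hv hne).1, (h v hv hne).2.1, (h v hv hne).2.2.mono fun u hu => hu.2⟩⟩
  choose P' z h using htrim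
  have hinj : ∀ i j hi hj, z i hi = z j hj → i = j := by
    intro i j hi hj hij
    by_contra hne
    exact Set.disjoint_left.mp (hdisj i hi j hj hne) ((h i hi).1 (h i hi).2.2.1)
      (hij ▸ (h j hj).1 (h j hj).2.2.1)
  have hsurj := Finset.surj_on_of_inj_on_of_card_le z (fun i hi => (h i hi).2.2.2.1) hinj hI.ge
  have hQ : ∀ y, ∃ Q : Set V, y ∈ Y → ∃ i, ∃ hi : i ∈ I, y = z i hi ∧ Q = P' i hi := by
    intro y
    by_cases hy : y ∈ Y
    · obtain ⟨i, hi, hyi⟩ := hsurj y hy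
      exact ⟨P' i hi, fun _ => ⟨i, hi, hyi, rfl⟩⟩
    · exact ⟨∅, fun h => absurd h hy⟩
  choose Q hQ using hQ
  refine ⟨Q, fun y hy => ?_, fun y hy y' hy' hne => ?_⟩
  · obtain ⟨i, hi, rfl, hQi⟩ := hQ y hy
    rw [hQi]
    exact ⟨(h i hi).2.1, (h i hi).2.2.1, (h i hi).2.2.2.2⟩
  · obtain ⟨i, hi, rfl, hQi⟩ := hQ y hy
    obtain ⟨j, hj, rfl, hQj⟩ := hQ y' hy'
    rw [hQi, hQj]
    refine (hdisj i hi j hj ?_).mono (h i hi).1 (h j hj).1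
    rintro rfl
    exact hne rfl

/-- **Menger's theorem** for finite graphs, with connected sets in place of paths. -/
theorem exists_linkage [Finite V] (G : SimpleGraph V) (A B : Set V) (k : ℕ)
    (hsep : ∀ T : Finset V, Separates G A B T → k ≤ T.card) :
    ∃ (I : Finset V) (P : V → Set V), I.card = k ∧
      (∀ i ∈ I, Conn G (P i) ∧ (P i ∩ A).Nonempty ∧ (P i ∩ B).Nonempty) ∧
      ∀ i ∈ I, ∀ j ∈ I, i ≠ j → Disjoint (P i) (P j) := by
  classical
  have := Fintype.ofFinite V
  induction hm : G.edgeSet.ncard using Nat.strong_induction_on generalizing G A B with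
  | _ m IH =>
  by_cases hE : ∃ x y, G.Adj x y
  swap
  · have hAB : k ≤ (A ∩ B).toFinset.card := by
      refine hsep _ fun a ha haS b hb hbS hab => ?_
      rcases hab.cases_head with rfl | ⟨c, h, -⟩
      · exact haS (by simpa using ⟨ha, hb⟩)
      · exact hE ⟨a, c, h.1⟩
    obtain ⟨I, hI, hIk⟩ := Finset.exists_subset_card_eq hAB
    refine ⟨I, fun i => {i}, hIk, fun i hi => ?_, fun i _ j _ hij => by simpa using hij⟩
    have := hI hi
    simp only [Set.mem_toFinset] at this
    exact ⟨conn_singleton, ⟨i, rfl, this.1⟩, ⟨i, rfl, this.2⟩⟩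
  obtain ⟨x₀, y₀, he⟩ := hE
  set G' := G.deleteEdges {s(x₀, y₀)} with hG'def
  have hG'G : G' ≤ G := G.deleteEdges_le _
  have hlt : G'.edgeSet.ncard < m := by
    rw [← hm]
    refine Set.ncard_lt_ncard ?_ (Set.toFinite _)
    refine ⟨SimpleGraph.edgeSet_mono hG'G, fun h => ?_⟩
    have := h (G.mem_edgeSet.mpr he)
    simp [hG'def] at this
  by_cases hs' : ∀ T : Finset V, Separates G' A B T → k ≤ T.card
  · obtain ⟨I, P, hI, hP, hd⟩ := IH _ hlt G' A B hs' rfl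
    exact ⟨I, P, hI, fun i hi => ⟨(hP i hi).1.mono_graph hG'G, (hP i hi).2⟩, hd⟩
  push Not at hs'
  obtain ⟨S, hS, hSk⟩ := hs'
  have hadj₀ : ∀ u w, G.Adj u w → G'.Adj u w ∨ (u = x₀ ∧ w = y₀) ∨ (u = y₀ ∧ w = x₀) := by
    intro u w huw
    by_cases h : s(u, w) = s(x₀, y₀)
    · right
      simpa using h
    · left
      simp only [hG'def, SimpleGraph.deleteEdges_adj, Set.mem_singleton_iff]
      exact ⟨huw, h⟩
  have hnot : ¬ Separates G A B S := fun h => absurd (hsep S h) (by omega)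
  simp only [Separates, not_forall, not_not] at hnot
  obtain ⟨a, ha, haS, b, hb, hbS, hab⟩ := hnot
  obtain ⟨x, y, hxy, hadj, hax, hyb⟩ : ∃ x y, G.Adj x y ∧
      (∀ u w, G.Adj u w → G'.Adj u w ∨ (u = x ∧ w = y) ∨ (u = y ∧ w = x)) ∧
      Reach G' (↑S)ᶜ a x ∧ Reach G' (↑S)ᶜ y b := by
    rcases hab.deleteEdge hadj₀ with h | h | h
    · exact absurd h (hS a ha haS b hb hbS)
    · exact ⟨x₀, y₀, he, hadj₀, h⟩
    · exact ⟨y₀, x₀, he.symm, fun u w huw => (hadj₀ u w huw).imp_right Or.symm, h⟩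
  have hadj' : ∀ u w, G.Adj u w → G'.Adj u w ∨ (u = y ∧ w = x) ∨ (u = x ∧ w = y) :=
    fun u w huw => (hadj u w huw).imp_right Or.symm
  have hxS : x ∉ S := hax.mem haS
  have hyS : y ∉ S := hyb.mem_left hbS
  have hA : ∀ T : Finset V, Separates G' A ↑(insert x S) T → Separates G A B T := by
    intro T hT
    rw [Finset.coe_insert] at hT
    exact hS.of_insert hadj hb hbS hyb hT
  have hB : ∀ T : Finset V, Separates G' B ↑(insert y S) T → Separates G A B T := by
    intro T hT
    rw [Finset.coe_insert] at hT
    exact (hS.symm.of_insert hadj' ha haS hax.symm hT).symm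
  have hk : (insert x S).card = k := by
    have h1 := hsep (insert x S) (hA _ fun a _ _ c hc hcS _ => hcS hc)
    rw [Finset.card_insert_of_notMem hxS] at h1 ⊢
    omega
  have hky : (insert y S).card = k := by
    rw [Finset.card_insert_of_notMem hxS] at hk
    rw [Finset.card_insert_of_notMem hyS, hk]
  obtain ⟨I, P₀, hI, hP₀, hPd₀⟩ := IH _ hlt G' A ↑(insert x S) (fun T hT => hsep T (hA T hT)) rfl
  obtain ⟨J, Q₀, hJ, hQ₀, hQd₀⟩ := IH _ hlt G' B ↑(insert y S) (fun T hT => hsep T (hB T hT)) rfl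
  obtain ⟨P, hP, hPd⟩ := exists_indexed_linkage (hI.trans hk.symm) hP₀ hPd₀
  obtain ⟨Q, hQ, hQd⟩ := exists_indexed_linkage (hJ.trans hky.symm) hQ₀ hQd₀
  have hSR : ∀ a' ∈ A, a' ∉ S → ∀ b' ∈ B, b' ∉ S → ∀ v, Reach G' (↑S)ᶜ a' v →
      Reach G' (↑S)ᶜ b' v → False :=
    fun a' ha' ha'S b' hb' hb'S v h h' => hS a' ha' ha'S b' hb' hb'S (h.trans h'.symm)
  have hPR : ∀ i ∈ insert x S, ∀ v ∈ P i,
      (v = i ∧ i ∈ S) ∨ (v ∉ S ∧ ∃ a' ∈ A, a' ∉ S ∧ Reach G' (↑S)ᶜ a' v) := by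
    intro i hi v hv
    obtain ⟨-, -, a', -, ha', h⟩ := hP i hi
    by_cases hvi : v = i
    · subst hvi
      rcases Finset.mem_insert.mp hi with rfl | hi
      · exact .inr ⟨hxS, a, ha, haS, hax⟩
      · exact .inl ⟨rfl, hi⟩
    · obtain ⟨h1, h2, h3⟩ := h v hv hvi
      simp only [Finset.mem_insert, not_or] at h1 h2
      exact .inr ⟨h1.2, a', ha', h2.2, h3.mono (by simp)⟩
  have hQR : ∀ i ∈ insert y S, ∀ v ∈ Q i,
      (v = i ∧ i ∈ S) ∨ (v ∉ S ∧ ∃ b' ∈ B, b' ∉ S ∧ Reach G' (↑S)ᶜ b' v) := by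
    intro i hi v hv
    obtain ⟨-, -, b', -, hb', h⟩ := hQ i hi
    by_cases hvi : v = i
    · subst hvi
      rcases Finset.mem_insert.mp hi with rfl | hi
      · exact .inr ⟨hyS, b, hb, hbS, hyb.symm⟩
      · exact .inl ⟨rfl, hi⟩
    · obtain ⟨h1, h2, h3⟩ := h v hv hvi
      simp only [Finset.mem_insert, not_or] at h1 h2
      exact .inr ⟨h1.2, b', hb', h2.2, h3.mono (by simp)⟩
  let σ : V → V := fun i => if i = x then y else i
  have hσ : ∀ i ∈ insert x S, σ i ∈ insert y S ∧ (i ∈ S → σ i = i) ∧ (σ i ∈ S → σ i = i) := by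
    intro i hi
    rcases Finset.mem_insert.mp hi with rfl | hi
    · simp [σ, hxS, hyS]
    · have : i ≠ x := fun h => hxS (h ▸ hi)
      simp [σ, this, hi]
  have hσinj : ∀ i ∈ insert x S, ∀ j ∈ insert x S, i ≠ j → σ i ≠ σ j := by
    intro i hi j hj hij
    rcases Finset.mem_insert.mp hi with rfl | hi' <;>
      rcases Finset.mem_insert.mp hj with rfl | hj'
    · exact absurd rfl hij
    · simp only [σ, if_true, if_neg hij.symm]
      exact fun h => hyS (h ▸ hj')
    · simp only [σ, if_true, if_neg hij]
      exact fun h => hyS (h ▸ hi')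
    · rwa [(hσ i hi).2.1 hi', (hσ j hj).2.1 hj']
  have hPQ : ∀ i ∈ insert x S, ∀ j ∈ insert x S, i ≠ j → Disjoint (P i) (Q (σ j)) := by
    intro i hi j hj hij
    refine Set.disjoint_left.mpr fun v hv hv' => ?_
    rcases hPR i hi v hv with ⟨rfl, h⟩ | ⟨h, a', ha', ha'S, h'⟩ <;>
      rcases hQR _ (hσ j hj).1 v hv' with ⟨h1, h2⟩ | ⟨h1, b', hb', hb'S, h2⟩
    · exact hij (h1.trans ((hσ j hj).2.2 h2))
    · exact h1 h
    · exact h (h1 ▸ h2)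
    · exact hSR a' ha' ha'S b' hb' hb'S v h' h2
  refine ⟨insert x S, fun i => P i ∪ Q (σ i), hk, fun i hi => ?_, fun i hi j hj hij => ?_⟩
  · obtain ⟨hPc, hPi, a', ha'P, ha', -⟩ := hP i hi
    obtain ⟨hQc, hQi, b', hb'P, hb', -⟩ := hQ _ (hσ i hi).1
    refine ⟨(hPc.mono_graph hG'G).union (hQc.mono_graph hG'G) hPi hQi ?_,
      ⟨a', .inl ha'P, ha'⟩, ⟨b', .inr hb'P, hb'⟩⟩
    rcases Finset.mem_insert.mp hi with rfl | hi'
    · right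
      simpa [σ] using hxy
    · exact .inl ((hσ i hi).2.1 hi').symm
  · simp only [Set.disjoint_union_left, Set.disjoint_union_right]
    exact ⟨⟨hPd i hi j hj hij, (hPQ j hj i hi hij.symm).symm⟩,
      hPQ i hi j hj hij, hQd _ (hσ i hi).1 _ (hσ j hj).1 (hσinj i hi j hj hij)⟩

end Menger

/-- `r` retracts `U` onto `X` in such a way that all its fibres are connected. -/
structure IsRetraction (G : SimpleGraph V) (U X : Set V) (r : V → V) : Prop where
  subset : X ⊆ U
  fix : ∀ x ∈ X, r x = x
  maps : ∀ u ∈ U, r u ∈ X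
  conn : ∀ x ∈ X, Conn G {u | u ∈ U ∧ r u = x}

section Retraction

variable {G : SimpleGraph V} {U X N : Set V} {r : V → V} {x : V}

/-- A retraction defined on a nonempty part `M` of a connected set `U` extends to `U`. -/
lemma IsRetraction.exists_extend [Finite V] {M : Set V} (hr : IsRetraction G M X r)
    (hMU : M ⊆ U) (hU : Conn G U) (hM : M.Nonempty) :
    ∃ r', IsRetraction G U X r' ∧ ∀ u ∈ M, r' u = r u := by
  classical
  induction hn : (U \ M).ncard using Nat.strong_induction_on generalizing M r with
  | _ n IH =>
  by_cases hUM : U ⊆ M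
  · obtain rfl := hMU.antisymm hUM
    exact ⟨r, hr, fun _ _ => rfl⟩
  obtain ⟨u, huU, huM⟩ := Set.not_subset.mp hUM
  obtain ⟨m, hm⟩ := hM
  obtain ⟨a, haM, b, hbM, hab, -, hbU⟩ := (hU m (hMU hm) u huU).exists_leaving hm huM
  have hne : ∀ v ∈ M, v ≠ b := fun v hv h => hbM (h ▸ hv)
  have hupd : ∀ v ∈ M, Function.update r b (r a) v = r v := fun v hv =>
    Function.update_of_ne (hne v hv) _ _
  have hr' : IsRetraction G (insert b M) X (Function.update r b (r a)) := by
    refine ⟨hr.subset.trans (Set.subset_insert _ _), fun x hx => ?_, fun v hv => ?_,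
      fun x hx => ?_⟩
    · rw [hupd x (hr.subset hx), hr.fix x hx]
    · rcases hv with rfl | hv
      · simpa using hr.maps a haM
      · rw [hupd v hv]
        exact hr.maps v hv
    · by_cases hxa : r a = x
      · have : {u | u ∈ insert b M ∧ Function.update r b (r a) u = x} =
            insert b {u | u ∈ M ∧ r u = x} := by
          ext v
          by_cases hv : v = b
          · subst hv
            simp [hxa]
          · simp [hv]
        rw [this]
        exact conn_insert (hr.conn x hx) ⟨haM, hxa⟩ hab.symm
      · have : {u | u ∈ insert b M ∧ Function.update r b (r a) u = x} =
            {u | u ∈ M ∧ r u = x} := by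
          ext v
          by_cases hv : v = b
          · subst hv
            simp [hxa, hbM]
          · simp [hv]
        rw [this]
        exact hr.conn x hx
  have hlt : (U \ insert b M).ncard < n := by
    rw [← hn]
    refine Set.ncard_lt_ncard ⟨fun v hv => ⟨hv.1, fun h => hv.2 (.inr h)⟩, fun h => ?_⟩
      (Set.toFinite _)
    exact (h ⟨hbU, hbM⟩).2 (.inl rfl)
  obtain ⟨r', h1, h2⟩ := IH _ hlt hr' (Set.insert_subset hbU hMU) ⟨b, .inl rfl⟩ rfl
  exact ⟨r', h1, fun v hv => (h2 v (.inr hv)).trans (hupd v hv)⟩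

/-- Part of a fibre can be handed over to an adjacent fibre. -/
lemma IsRetraction.exists_move (hr : IsRetraction G U X r) {D₁ D₂ : Set V}
    (hD : {u | u ∈ U ∧ r u = x} = D₁ ∪ D₂) (hdisj : Disjoint D₁ D₂) (hx : x ∈ X) (hxD : x ∈ D₁)
    (hD₁ : Conn G D₁) (hD₂ : Conn G D₂) {d w : V} (hd : d ∈ D₂) (hw : w ∈ U) (hwx : r w ≠ x)
    (hdw : G.Adj d w) :
    ∃ r', IsRetraction G U X r' ∧ (∀ u ∉ D₂, r' u = r u) ∧ ∀ u ∈ D₂, r' u = r w := by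
  classical
  have hD₂U : ∀ u ∈ D₂, u ∈ U ∧ r u = x := fun u hu => (Set.ext_iff.mp hD u).mpr (.inr hu)
  have h1 : ∀ u ∉ D₂, (if u ∈ D₂ then r w else r u) = r u := fun u hu => if_neg hu
  have h2 : ∀ u ∈ D₂, (if u ∈ D₂ then r w else r u) = r w := fun u hu => if_pos hu
  refine ⟨fun u => if u ∈ D₂ then r w else r u, ⟨hr.subset, fun y hy => ?_, fun u hu => ?_,
    fun y hy => ?_⟩, h1, h2⟩
  · have hy' : y ∉ D₂ := by
      intro h
      have := (hD₂U y h).2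
      rw [hr.fix y hy] at this
      exact Set.disjoint_left.mp hdisj hxD (this ▸ h)
    exact (h1 y hy').trans (hr.fix y hy)
  · by_cases h : u ∈ D₂
    · exact (h2 u h).symm ▸ hr.maps w hw
    · exact (h1 u h).symm ▸ hr.maps u hu
  · by_cases hyx : y = x
    · subst hyx
      convert hD₁ using 1
      ext u
      have := Set.ext_iff.mp hD u
      have : u ∈ D₁ → u ∉ D₂ := fun h => Set.disjoint_left.mp hdisj h
      have := h1 u
      have := h2 u
      simp only [Set.mem_union, Set.mem_ofPred_eq] at *
      grind
    · by_cases hyw : y = r w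
      · have : {u | u ∈ U ∧ (if u ∈ D₂ then r w else r u) = y} =
            {u | u ∈ U ∧ r u = y} ∪ D₂ := by
          ext u
          have := hD₂U u
          simp only [Set.mem_union, Set.mem_ofPred_eq] at *
          grind
        rw [this]
        exact (hr.conn y hy).union hD₂ (x := w) ⟨hw, hyw.symm⟩ hd (.inr hdw.symm)
      · convert hr.conn y hy using 1
        ext u
        have := hD₂U u
        simp only [Set.mem_ofPred_eq] at *
        grind

/-- If a set `N` lies in one fibre but is not separated from `X` by a single vertex, then
that fibre can be shrunk so that `N` meets two fibres. -/
lemma IsRetraction.exists_split [Finite V] (hr : IsRetraction G U X r) (hx : x ∈ X)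
    (hN : ∀ n ∈ N, n ∈ U ∧ r n = x)
    (hsep : ∀ t, ∃ n ∈ N, n ≠ t ∧ ∃ c ∈ X, c ≠ t ∧ Reach G (U \ {t}) n c) :
    ∃ r', IsRetraction G U X r' ∧ (∀ u ∈ U, r u ≠ x → r' u = r u) ∧
      ∃ n ∈ N, ∃ n' ∈ N, r' n ≠ r' n' := by
  induction hm : {u | u ∈ U ∧ r u = x}.ncard using Nat.strong_induction_on generalizing r with
  | _ m IH =>
  set D : Set V := {u | u ∈ U ∧ r u = x} with hD
  have hDc : Conn G D := hr.conn x hx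
  have hxD : x ∈ D := ⟨hr.subset hx, hr.fix x hx⟩
  let K : V → Set V := fun d => {v | Reach G (D \ {d}) x v}
  have hKD : ∀ d, d ≠ x → K d ⊆ D \ {d} := fun d hd v hv =>
    Reach.mem hv ⟨hxD, fun h => hd h.symm⟩
  have hxK : ∀ d, x ∈ K d := fun d => Reach.refl
  have hKadj : ∀ d, d ≠ x → ∀ a ∈ K d, ∀ b ∈ D, G.Adj a b → b ≠ d → b ∈ K d :=
    fun d hd a ha b hb hab hbd => Reach.tail ha hab (hKD d hd ha) ⟨hb, hbd⟩
  by_cases hE : ∃ d ∈ D, d ≠ x ∧ (∃ w ∈ U, r w ≠ x ∧ G.Adj d w) ∧ (N ∩ K d).Nonempty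
  · obtain ⟨d, hd, hdx, ⟨w, hw, hwx, hdw⟩, ⟨n, hn, hnK⟩⟩ := hE
    obtain ⟨r', hr', h1, h2⟩ := hr.exists_move (D₁ := K d) (D₂ := D \ K d)
      (by rw [Set.union_sdiff_cancel ((hKD d hdx).trans Set.sdiff_subset)])
      Set.disjoint_sdiff_right hx (hxK d) conn_component
      (conn_diff_component hDc (by simpa using hd) conn_singleton rfl
        ⟨hxD, fun h => hdx h.symm⟩) ⟨hd, fun h => (hKD d hdx h).2 rfl⟩ hw hwx hdw
    have hagree : ∀ u ∈ U, r u ≠ x → r' u = r u := fun u _ hux => h1 u fun h => hux h.1.2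
    by_cases hNK : N ⊆ K d
    · have hfib : {u | u ∈ U ∧ r' u = x} ⊆ K d := by
        rintro u ⟨huU, hux⟩
        by_contra huK
        by_cases hu : r u = x
        · exact hwx ((h2 u ⟨⟨huU, hu⟩, huK⟩).symm.trans hux)
        · exact hu ((hagree u huU hu).symm.trans hux)
      have hlt : {u | u ∈ U ∧ r' u = x}.ncard < m := by
        rw [← hm]
        refine Set.ncard_lt_ncard ⟨fun u hu => (hKD d hdx (hfib hu)).1, fun h => ?_⟩
          (Set.toFinite _)
        exact (hKD d hdx (hfib (h hd))).2 rfl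
      obtain ⟨r'', h3, h4, h5⟩ := IH _ hlt hr' (fun n hn =>
        ⟨(hN n hn).1, (h1 n fun h => h.2 (hNK hn)).trans (hN n hn).2⟩) rfl
      exact ⟨r'', h3, fun u hu hux => (h4 u hu (by rwa [hagree u hu hux])).trans
        (hagree u hu hux), h5⟩
    · obtain ⟨n', hn', hn'K⟩ := Set.not_subset.mp hNK
      refine ⟨r', hr', hagree, n, hn, n', hn', ?_⟩
      rw [h1 n fun h => h.2 hnK, h2 n' ⟨hN n' hn', hn'K⟩, (hN n hn).2]
      exact hwx.symm
  · exfalso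
    let E : Set V := {d | d ∈ D ∧ d ≠ x ∧ ∃ w ∈ U, r w ≠ x ∧ G.Adj d w}
    have hEN : ∀ d ∈ E, ∀ n ∈ N, n ∉ K d := fun d hd n hn hnK =>
      hE ⟨d, hd.1, hd.2.1, hd.2.2, n, hn, hnK⟩
    have hEne : E.Nonempty := by
      obtain ⟨n, hn, hnx, c, hc, hcx, h⟩ := hsep x
      obtain ⟨a, ha, b, hb, hab, haU, hbU⟩ := h.exists_leaving (D := D) (hN n hn)
        (fun h => hcx ((hr.fix c hc).symm.trans h.2))
      exact ⟨a, ha, haU.2, b, hbU.1, fun h => hb ⟨hbU.1, h⟩, hab⟩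
    obtain ⟨d, hd, hmax⟩ := Set.exists_max_image E (fun d => (K d).ncard) (Set.toFinite _) hEne
    have hdx := hd.2.1
    obtain ⟨n, hn, hnd, c, hc, hcd, h⟩ := hsep d
    obtain ⟨a, ⟨⟨haD, haK⟩, had⟩, b, hb, hab, haU, hbU⟩ :=
      h.exists_leaving (D := (D \ K d) \ {d}) ⟨⟨hN n hn, hEN d hd n hn⟩, hnd⟩
        (fun h => h.1.2 (((hr.fix c hc).symm.trans h.1.1.2).symm ▸ hxK d))
    have hbD : b ∉ D := by
      intro hbD
      have hbK : b ∈ K d := by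
        by_contra hbK
        exact hb ⟨⟨hbD, hbK⟩, hbU.2⟩
      exact haK (hKadj d hdx b hbK a haD hab.symm had)
    have hax : a ≠ x := fun h => haK (h ▸ hxK d)
    have haE : a ∈ E := ⟨haD, hax, b, hbU.1, fun h => hbD ⟨hbU.1, h⟩, hab⟩
    have hsub : K d ⊆ K a := fun v hv => (reach_component hv).mono fun u hu =>
      ⟨(hKD d hdx hu).1, fun h => haK (h ▸ hu)⟩
    have hdK : d ∉ K d := fun h => (hKD d hdx h).2 rfl
    have hdKa : d ∈ K a := by
      obtain ⟨a', ha', b', hb', hab', -, hb'D⟩ :=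
        (hDc x hxD d hd.1).exists_leaving (hxK d) hdK
      have : b' = d := by
        by_contra hne
        exact hb' (hKadj d hdx a' ha' b' hb'D hab' hne)
      subst this
      exact hKadj a hax a' (hsub ha') b' hb'D hab' (fun h => had h.symm)
    have hlt : (K d).ncard < (K a).ncard :=
      Set.ncard_lt_ncard ⟨hsub, fun h => hdK (h hdKa)⟩ (Set.toFinite _)
    exact absurd (hmax a haE) (by omega)

end Retraction

section Marks

lemma ncard_pair_le (p q : V) : ({p, q} : Set V).ncard ≤ 2 :=
  (Set.ncard_insert_le p {q}).trans (by rw [Set.ncard_singleton])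

variable {G : SimpleGraph V} {U X N N₁ N₂ : Set V}

/-- If `N` is not separated from `X` within `U` by two vertices, then `U` retracts onto `X`
in such a way that `N` meets three fibres. -/
lemma exists_retraction_three [Finite V] (hU : Conn G U) (hXU : X ⊆ U) (hNU : N ⊆ U)
    (hsep : ∀ T : Finset V, T.card ≤ 2 →
      ∃ n ∈ N, n ∉ T ∧ ∃ c ∈ X, c ∉ T ∧ Reach G (U ∩ (↑T)ᶜ) n c) :
    ∃ r, IsRetraction G U X r ∧ ∃ a ∈ N, ∃ b ∈ N, ∃ c ∈ N, r a ≠ r b ∧ r a ≠ r c ∧ r b ≠ r c := by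
  let H : SimpleGraph V := SimpleGraph.fromRel fun a b => G.Adj a b ∧ a ∈ U ∧ b ∈ U
  have hH : ∀ a b, H.Adj a b ↔ G.Adj a b ∧ a ∈ U ∧ b ∈ U := by
    intro a b
    simp only [H, SimpleGraph.fromRel_adj]
    constructor
    · rintro ⟨-, h | h⟩
      · exact h
      · exact ⟨h.1.symm, h.2.2, h.2.1⟩
    · exact fun h => ⟨h.1.ne, .inl h⟩
  have hHG : H ≤ G := fun a b h => ((hH a b).mp h).1
  obtain ⟨I, P, hI, hP, hPd⟩ := exists_linkage H N X 3 (fun T hT => by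
    by_contra hlt
    obtain ⟨n, hn, hnT, c, hc, hcT, h⟩ := hsep T (by omega)
    exact hT n hn hnT c hc hcT (h.mono' fun a ha b hb hab =>
      ⟨(hH a b).mpr ⟨hab, ha.1, hb.1⟩, ha.2, hb.2⟩))
  have htrim : ∀ i ∈ I, ∃ (P' : Set V) (z n : V), P' ⊆ P i ∧ Conn G P' ∧ P' ⊆ U ∧ z ∈ P' ∧
      z ∈ X ∧ (∀ v ∈ P', v ∈ X → v = z) ∧ n ∈ P' ∧ n ∈ N := by
    intro i hi
    obtain ⟨hc, ⟨n, hn, hnN⟩, ⟨y, hy, hyX⟩⟩ := hP i hi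
    obtain ⟨P', hP'P, hc', hnP', z, hz, hzX, h⟩ := hc.exists_trim hn hy hyX
    refine ⟨P', z, n, hP'P, hc'.mono_graph hHG, fun v hv => ?_, hz, hzX, fun v hv hvX => ?_,
      hnP', hnN⟩
    · rcases (hc' n hnP' v hv).cases_tail with rfl | ⟨w, -, h⟩
      · exact hNU hnN
      · exact ((hH _ _).mp h.1).2.2
    · by_contra hne
      exact (h v hv hne).1 hvX
  choose P' z n hP'P hP'c hP'U hzP' hzX hz hnP' hnN using htrim
  have hidx : ∀ i hi j hj v, v ∈ P' i hi → v ∈ P' j hj → i = j := by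
    intro i hi j hj v hv hv'
    by_contra hne
    exact Set.disjoint_left.mp (hPd i hi j hj hne) (hP'P i hi hv) (hP'P j hj hv')
  have hex : ∀ v, ∃ y, (∀ i hi, v ∈ P' i hi → y = z i hi) ∧ ((∀ i hi, v ∉ P' i hi) → y = v) := by
    intro v
    by_cases h : ∃ i, ∃ hi, v ∈ P' i hi
    · obtain ⟨i, hi, hv⟩ := h
      refine ⟨z i hi, fun j hj hv' => ?_, fun h => absurd hv (h i hi)⟩
      obtain rfl := hidx i hi j hj v hv hv'
      rfl
    · exact ⟨v, fun i hi hv => absurd ⟨i, hi, hv⟩ h, fun _ => rfl⟩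
  choose r hr hr' using hex
  let M : Set V := {v | v ∈ X ∨ ∃ i, ∃ hi, v ∈ P' i hi}
  have hfix : ∀ x ∈ X, r x = x := by
    intro x hx
    by_cases h : ∃ i, ∃ hi, x ∈ P' i hi
    · obtain ⟨i, hi, hxi⟩ := h
      rw [hr x i hi hxi, hz i hi x hxi hx]
    · exact hr' x fun i hi hxi => h ⟨i, hi, hxi⟩
  have hM : IsRetraction G M X r := by
    refine ⟨fun x hx => .inl hx, hfix, fun u hu => ?_, fun y hy => ?_⟩
    · rcases hu with hu | ⟨i, hi, hu⟩
      · exact (hfix u hu).symm ▸ hu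
      · exact (hr u i hi hu).symm ▸ hzX i hi
    · by_cases h : ∃ i, ∃ hi, z i hi = y
      · obtain ⟨i, hi, rfl⟩ := h
        convert hP'c i hi using 1
        ext u
        constructor
        · rintro ⟨hu, huz⟩
          by_cases h : ∃ j, ∃ hj, u ∈ P' j hj
          · obtain ⟨j, hj, huj⟩ := h
            have hzz : z j hj = z i hi := (hr u j hj huj).symm.trans huz
            obtain rfl := hidx j hj i hi _ (hzP' j hj) (hzz ▸ hzP' i hi)
            exact huj
          · have : u = z i hi := (hr' u fun j hj huj => h ⟨j, hj, huj⟩).symm.trans huz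
            exact this ▸ hzP' i hi
        · exact fun hu => ⟨.inr ⟨i, hi, hu⟩, hr u i hi hu⟩
      · convert (conn_singleton : Conn G {y}) using 1
        ext u
        constructor
        · rintro ⟨hu, huy⟩
          by_cases h' : ∃ j, ∃ hj, u ∈ P' j hj
          · obtain ⟨j, hj, huj⟩ := h'
            exact absurd ⟨j, hj, (hr u j hj huj).symm.trans huy⟩ h
          · exact (hr' u fun j hj huj => h' ⟨j, hj, huj⟩).symm.trans huy
        · rintro rfl
          exact ⟨.inl hy, hfix u hy⟩
  obtain ⟨i, j, k, hi, hj, hk, hij, hik, hjk⟩ :=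
    Finset.two_lt_card_iff.mp (show 2 < I.card by omega)
  obtain ⟨r₁, h₁, h₂⟩ := hM.exists_extend (U := U)
    (by
      rintro v (hv | ⟨i, hi, hv⟩)
      · exact hXU hv
      · exact hP'U i hi hv) hU ⟨_, .inl (hzX i hi)⟩
  have hval : ∀ i hi, r₁ (n i hi) = z i hi := fun i hi =>
    (h₂ _ (.inr ⟨i, hi, hnP' i hi⟩)).trans (hr _ i hi (hnP' i hi))
  have hne : ∀ i hi j hj, i ≠ j → r₁ (n i hi) ≠ r₁ (n j hj) := by
    intro i hi j hj hij h
    rw [hval, hval] at h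
    exact hij (hidx i hi j hj _ (hzP' i hi) (h ▸ hzP' j hj))
  exact ⟨r₁, h₁, n i hi, hnN i hi, n j hj, hnN j hj, n k hk, hnN k hk, hne _ _ _ _ hij,
    hne _ _ _ _ hik, hne _ _ _ _ hjk⟩

lemma IsRetraction.exists_two_two [Finite V] {r : V → V} (hr : IsRetraction G U X r)
    (hN₂U : N₂ ⊆ U) (hN₁U : N₁ ⊆ U)
    {a b c : V} (ha : a ∈ N₁ ∪ N₂) (hb : b ∈ N₁ ∪ N₂) (hc : c ∈ N₁ ∪ N₂)
    (hab : r a ≠ r b) (hac : r a ≠ r c) (hbc : r b ≠ r c)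
    (hsep : ∀ t, ∃ n ∈ N₂, n ≠ t ∧ ∃ c ∈ X, c ≠ t ∧ Reach G (U \ {t}) n c)
    (hN : ∀ n ∈ N₂, ∀ n' ∈ N₂, r n = r n') :
    ∃ r', IsRetraction G U X r' ∧ (∃ n ∈ N₁, ∃ n' ∈ N₁, r' n ≠ r' n') ∧
      ∃ n ∈ N₂, ∃ n' ∈ N₂, r' n ≠ r' n' := by
  obtain ⟨m, hm, -⟩ := hsep a
  have hmX := hr.maps m (hN₂U hm)
  obtain ⟨r', hr', hag, hsp⟩ := hr.exists_split hmX
    (fun n hn => ⟨hN₂U hn, hN n hn m hm⟩) hsep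
  have hN₁ : ∀ u ∈ N₁ ∪ N₂, r u ≠ r m → u ∈ N₁ := fun u hu hum =>
    hu.resolve_right fun h => hum (hN u h m hm)
  have hfin : ∀ u ∈ N₁ ∪ N₂, ∀ v ∈ N₁ ∪ N₂, r u ≠ r m → r v ≠ r m → r u ≠ r v →
      ∃ n ∈ N₁, ∃ n' ∈ N₁, r' n ≠ r' n' := by
    intro u hu v hv hum hvm huv
    refine ⟨u, hN₁ u hu hum, v, hN₁ v hv hvm, ?_⟩
    rwa [hag u (hN₁U (hN₁ u hu hum)) hum, hag v (hN₁U (hN₁ v hv hvm)) hvm]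
  refine ⟨r', hr', ?_, hsp⟩
  by_cases ham : r a = r m
  · exact hfin b hb c hc (ham ▸ hab.symm) (ham ▸ hac.symm) hbc
  · by_cases hbm : r b = r m
    · exact hfin a ha c hc ham (hbm ▸ hbc.symm) hac
    · exact hfin a ha b hb ham hbm hab

/-- Deleting `p` and `q` from a 3-connected graph, the neighbours of `q` are not separated by
one vertex from any set with two elements. -/
lemma exists_reach_avoiding_one {p q : V} (hW : ∀ W : Set V, W.ncard ≤ 2 → Conn G Wᶜ)
    (hpq : p ≠ q) (hX : X ⊆ {p, q}ᶜ) {x y : V} (hx : x ∈ X) (hy : y ∈ X) (hxy : x ≠ y) (t : V) :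
    ∃ n ∈ {u | u ∈ ({p, q}ᶜ : Set V) ∧ G.Adj q u}, n ≠ t ∧
      ∃ c ∈ X, c ≠ t ∧ Reach G ({p, q}ᶜ \ {t}) n c := by
  obtain ⟨c, hc, hct⟩ : ∃ c ∈ X, c ≠ t := by
    by_cases h : x = t
    · exact ⟨y, hy, fun h' => hxy (h.trans h'.symm)⟩
    · exact ⟨x, hx, h⟩
  have hcpq := hX hc
  simp only [Set.mem_compl_iff, Set.mem_insert_iff, Set.mem_singleton_iff, not_or] at hcpq
  have hWc : Conn G (({p, t} : Set V) \ {q})ᶜ := hW _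
    ((Set.ncard_le_ncard Set.sdiff_subset (Set.toFinite _)).trans (ncard_pair_le p t))
  obtain ⟨z, hz, a, ha, hza, haW, hac⟩ := (hWc q (by simp) c (by
    simp [hcpq, hct])).exists_last_exit (Z := {q}) rfl (by simpa using hcpq.2)
  obtain rfl : z = q := hz
  simp only [Set.mem_singleton_iff] at ha
  simp only [Set.mem_compl_iff, Set.mem_sdiff, Set.mem_insert_iff, Set.mem_singleton_iff,
    ha, not_false_eq_true, and_true, not_or] at haW
  refine ⟨a, ⟨by simp [ha, haW], hza⟩, haW.2, c, hc, hct, hac.mono fun u hu => ?_⟩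
  have h1 := hu.1
  have h2 := hu.2
  simp only [Set.mem_compl_iff, Set.mem_sdiff, Set.mem_insert_iff, Set.mem_singleton_iff] at *
  tauto

lemma exists_reach_avoiding_two {p q : V} (hW : ∀ W : Set V, W.ncard ≤ 2 → Conn G Wᶜ)
    (hX : X ⊆ {p, q}ᶜ) (hX3 : 3 ≤ X.ncard) (T : Finset V) (hT : T.card ≤ 2) :
    ∃ n ∈ {u | u ∈ ({p, q}ᶜ : Set V) ∧ G.Adj p u} ∪ {u | u ∈ ({p, q}ᶜ : Set V) ∧ G.Adj q u},
      n ∉ T ∧ ∃ c ∈ X, c ∉ T ∧ Reach G ({p, q}ᶜ ∩ (↑T)ᶜ) n c := by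
  obtain ⟨c, hc, hcT⟩ := Set.exists_mem_notMem_of_ncard_lt_ncard (s := (T : Set V)) (t := X)
    (by rw [Set.ncard_coe_finset]; omega)
  have hWc : Conn G ((T : Set V) \ {p})ᶜ := hW _
    ((Set.ncard_le_ncard Set.sdiff_subset (Set.toFinite _)).trans
      (by rwa [Set.ncard_coe_finset]))
  obtain ⟨z, hz, a, ha, hza, haW, hac⟩ := (hWc p (by simp) c
    fun h => hcT h.1).exists_last_exit (Z := {p, q}) (.inl rfl) (hX hc)
  have hap : a ≠ p := fun h => ha (.inl h)
  have haT : a ∉ T := fun h => haW ⟨h, hap⟩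
  refine ⟨a, ?_, haT, c, hc, hcT, hac.mono fun u hu => ⟨hu.2, fun h => hu.1 ⟨h, ?_⟩⟩⟩
  · rcases hz with rfl | rfl
    · exact .inl ⟨ha, hza⟩
    · exact .inr ⟨ha, hza⟩
  · exact fun h => hu.2 (.inl h)

/-- In a 3-connected graph, `V \ {p, q}` retracts onto any of its subsets with at least three
elements so that each of `p` and `q` has neighbours in at least two fibres. -/
lemma exists_retraction_two_two [Finite V] {p q : V}
    (hW : ∀ W : Set V, W.ncard ≤ 2 → Conn G Wᶜ)
    (hpq : p ≠ q) (hX : X ⊆ {p, q}ᶜ) (hX3 : 3 ≤ X.ncard) :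
    ∃ r, IsRetraction G {p, q}ᶜ X r ∧
      (∃ n ∈ {u | u ∈ ({p, q}ᶜ : Set V) ∧ G.Adj p u},
        ∃ n' ∈ {u | u ∈ ({p, q}ᶜ : Set V) ∧ G.Adj p u}, r n ≠ r n') ∧
      ∃ n ∈ {u | u ∈ ({p, q}ᶜ : Set V) ∧ G.Adj q u},
        ∃ n' ∈ {u | u ∈ ({p, q}ᶜ : Set V) ∧ G.Adj q u}, r n ≠ r n' := by
  set Np : Set V := {u | u ∈ ({p, q}ᶜ : Set V) ∧ G.Adj p u} with hNp
  set Nq : Set V := {u | u ∈ ({p, q}ᶜ : Set V) ∧ G.Adj q u} with hNq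
  have hNpU : Np ⊆ {p, q}ᶜ := fun u hu => hu.1
  have hNqU : Nq ⊆ {p, q}ᶜ := fun u hu => hu.1
  obtain ⟨r, hr, a, ha, b, hb, c, hc, hab, hac, hbc⟩ :=
    exists_retraction_three (hW _ (ncard_pair_le p q)) hX (Set.union_subset hNpU hNqU)
      (exists_reach_avoiding_two hW hX hX3)
  obtain ⟨x, hx, y, hy, hxy⟩ := (Set.one_lt_ncard (Set.toFinite X)).mp (by omega)
  have hsq := exists_reach_avoiding_one hW hpq hX hx hy hxy
  have hsp := exists_reach_avoiding_one (p := q) (q := p) hW hpq.symm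
    (by rwa [Set.pair_comm]) hx hy hxy
  simp only [Set.pair_comm q p] at hsp
  by_cases hq : ∃ n ∈ Nq, ∃ n' ∈ Nq, r n ≠ r n'
  · by_cases hp : ∃ n ∈ Np, ∃ n' ∈ Np, r n ≠ r n'
    · exact ⟨r, hr, hp, hq⟩
    · push Not at hp
      rw [Set.union_comm] at ha hb hc
      obtain ⟨r', h1, h2, h3⟩ := hr.exists_two_two hNpU hNqU ha hb hc hab hac hbc hsp hp
      exact ⟨r', h1, h3, h2⟩
  · push Not at hq
    exact hr.exists_two_two hNqU hNpU ha hb hc hab hac hbc hsq hq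

lemma exists_retraction_two [Finite V] {p q : V}
    (hW : ∀ W : Set V, W.ncard ≤ 2 → Conn G Wᶜ)
    (hpq : p ≠ q) (hX : X ⊆ {p, q}ᶜ) (hX2 : 2 ≤ X.ncard) :
    ∃ r, IsRetraction G {p, q}ᶜ X r ∧ ∃ n ∈ {u | u ∈ ({p, q}ᶜ : Set V) ∧ G.Adj q u},
        ∃ n' ∈ {u | u ∈ ({p, q}ᶜ : Set V) ∧ G.Adj q u}, r n ≠ r n' := by
  obtain ⟨x, hx, y, hy, hxy⟩ := (Set.one_lt_ncard (Set.toFinite X)).mp hX2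
  have hid : IsRetraction G X X id := by
    refine ⟨subset_rfl, fun _ _ => rfl, fun _ h => h, fun x hx => ?_⟩
    convert (conn_singleton : Conn G {x}) using 1
    ext u
    constructor
    · exact fun h => h.2
    · rintro rfl
      exact ⟨hx, rfl⟩
  obtain ⟨r, hr, -⟩ := hid.exists_extend hX (hW _ (ncard_pair_le p q)) ⟨x, hx⟩
  by_cases hq : ∃ n ∈ {u | u ∈ ({p, q}ᶜ : Set V) ∧ G.Adj q u},
        ∃ n' ∈ {u | u ∈ ({p, q}ᶜ : Set V) ∧ G.Adj q u}, r n ≠ r n'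
  · exact ⟨r, hr, hq⟩
  · push Not at hq
    have hsq := exists_reach_avoiding_one hW hpq hX hx hy hxy
    obtain ⟨m, hm, -⟩ := hsq x
    obtain ⟨r', h1, -, h2⟩ := hr.exists_split (hr.maps m hm.1)
      (fun n hn => ⟨hn.1, hq n hn m hm⟩) hsq
    exact ⟨r', h1, h2⟩

end Marks

section Bonds

variable {G : SimpleGraph V} {p q v : V}

lemma Conn.preconnected {P : Set V} (hP : Conn G P) : (G.induce P).Preconnected := by
  rintro ⟨u, hu⟩ ⟨w, hw⟩
  have h := hP u hu w hw
  induction h with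
  | refl => exact .rfl
  | tail _ h ih =>
    exact (ih h.2.1).trans (SimpleGraph.Adj.reachable (G := G.induce P) h.1)

lemma conn_of_preconnected {P : Set V} (hP : (G.induce P).Preconnected) : Conn G P := by
  intro u hu w hw
  obtain ⟨c⟩ := hP ⟨u, hu⟩ ⟨w, hw⟩
  suffices H : ∀ a b : P, (G.induce P).Walk a b → Reach G P a b from H _ _ c
  intro a b c
  induction c with
  | nil => exact .refl
  | @cons a b _ h _ ih => exact .head h a.2 b.2 ih

lemma isBond_cut_s12 {S : Set V} (hS : Conn G S) (hS' : Conn G Sᶜ) : IsBond G (cut G S) :=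
  ⟨S, rfl, hS.preconnected, hS'.preconnected⟩

/-- Disjoint connected sets `A` and `B` avoiding `p` and `q`, both adjacent to both `p` and `q`,
yield a set whose four variants with respect to `p` and `q` all define bonds. -/
lemma exists_bonds (hpq : p ≠ q) (hU : Conn G {p, q}ᶜ) {A B : Set V}
    (hAU : A ⊆ {p, q}ᶜ) (hBU : B ⊆ {p, q}ᶜ) (hA : Conn G A) (hB : Conn G B)
    (hAB : Disjoint A B) (hadj : G.Adj p q)
    (hpA : ∃ u ∈ A, G.Adj p u) (hpB : ∃ u ∈ B, G.Adj p u)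
    (hqA : ∃ u ∈ A, G.Adj q u) (hqB : ∃ u ∈ B, G.Adj q u) :
    ∃ S : Set V, p ∉ S ∧ q ∉ S ∧ A ⊆ S ∧ (∀ b ∈ B, b ∉ S) ∧
      ∀ T ∈ ({S, insert p S, insert q S, insert p (insert q S)} : Set (Set V)),
        IsBond G (cut G T) := by
  obtain ⟨a₁, ha₁, hpa⟩ := hpA
  obtain ⟨a₂, ha₂, hqa⟩ := hqA
  obtain ⟨b₁, hb₁, hpb⟩ := hpB
  obtain ⟨b₂, hb₂, hqb⟩ := hqB
  set U : Set V := {p, q}ᶜ with hUdef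
  have hBUA : B ⊆ U \ A := fun b hb => ⟨hBU hb, fun h => Set.disjoint_left.mp hAB h hb⟩
  set K : Set V := {u | Reach G (U \ A) b₁ u} with hKdef
  have hKU : K ⊆ U \ A := fun u hu => Reach.mem hu (hBUA hb₁)
  have hK : Conn G K := conn_component
  have hS : Conn G (U \ K) := conn_diff_component hU hAU hA ha₁ (hBUA hb₁)
  have hBK : B ⊆ K := fun b hb => (hB b₁ hb₁ b hb).mono hBUA
  have hAS : A ⊆ U \ K := fun a ha => ⟨hAU ha, fun h => (hKU h).2 ha⟩
  have hpU : p ∉ U := by simp [hUdef]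
  have hqU : q ∉ U := by simp [hUdef]
  have hpK : p ∉ K := fun h => hpU (hKU h).1
  have hqK : q ∉ K := fun h => hqU (hKU h).1
  have hmem : ∀ u, u ∈ U ↔ u ≠ p ∧ u ≠ q := fun u => by simp [hUdef]
  refine ⟨U \ K, fun h => hpU h.1, fun h => hqU h.1, hAS, fun b hb h => h.2 (hBK hb), ?_⟩
  have hqS := conn_insert hS (hAS ha₂) hqa
  have hqK' := conn_insert hK (hBK hb₂) hqb
  have hc : ∀ {P Q : Set V}, Conn G Q → (∀ u, u ∈ P ↔ u ∉ Q) → Conn G Pᶜ := by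
    intro P Q hQ h
    convert hQ using 1
    ext u
    simp [h u]
  rintro T (rfl | rfl | rfl | rfl)
  · refine isBond_cut_s12 hS (hc (conn_insert hqK' (.inl rfl) hadj) fun u => ?_)
    simp only [Set.mem_sdiff, Set.mem_insert_iff, hmem]
    tauto
  · refine isBond_cut_s12 (conn_insert hS (hAS ha₁) hpa) (hc hqK' fun u => ?_)
    simp only [Set.mem_sdiff, Set.mem_insert_iff, hmem]
    grind
  · refine isBond_cut_s12 hqS (hc (conn_insert hK (hBK hb₁) hpb) fun u => ?_)
    simp only [Set.mem_sdiff, Set.mem_insert_iff, hmem]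
    grind
  · refine isBond_cut_s12 (conn_insert hqS (.inl rfl) hadj) (hc hK fun u => ?_)
    simp only [Set.mem_sdiff, Set.mem_insert_iff, hmem]
    grind

/-- If membership in `T` changes exactly twice along a cycle, then the cut of `T` contains
exactly two edges of the cycle. -/
lemma ncard_cut_inter_edges {c : G.Walk v v} (hc : c.IsCycle) {T : Set V} {a b : ℕ} (hab : a ≠ b)
    (ha : a < c.length) (hb : b < c.length)
    (h : ∀ i < c.length, (c.getVert i ∈ T ↔ c.getVert (i + 1) ∈ T) ↔ (i ≠ a ∧ i ≠ b)) :
    (cut G T ∩ {e | e ∈ c.edges}).ncard = 2 := by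
  have hedge : ∀ i (hi : i < c.edges.length),
      c.edges[i] = s(c.getVert i, c.getVert (i + 1)) := fun i hi =>
    SimpleGraph.Walk.getElem_edges hi
  have hlen : c.edges.length = c.length := c.length_edges
  have hcut : ∀ i, i < c.length → (s(c.getVert i, c.getVert (i + 1)) ∈ cut G T ↔
      ¬ (c.getVert i ∈ T ↔ c.getVert (i + 1) ∈ T)) := by
    intro i hi
    constructor
    · rintro ⟨-, u, w, huw, hu, hw⟩ hiff
      rcases Sym2.eq_iff.mp huw with ⟨h1, h2⟩ | ⟨h1, h2⟩
      · rw [h1, h2] at hiff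
        exact hw (hiff.mp hu)
      · rw [h1, h2] at hiff
        exact hw (hiff.mpr hu)
    · intro hiff
      refine ⟨c.adj_getVert_succ hi, ?_⟩
      by_cases h1 : c.getVert i ∈ T
      · exact ⟨_, _, rfl, h1, fun h2 => hiff ⟨fun _ => h2, fun _ => h1⟩⟩
      · refine ⟨_, _, Sym2.eq_swap, ?_, h1⟩
        by_contra h2
        exact hiff ⟨fun h => absurd h h1, fun h => absurd h h2⟩
  rw [Set.ncard_eq_two]
  refine ⟨s(c.getVert a, c.getVert (a + 1)), s(c.getVert b, c.getVert (b + 1)), ?_, ?_⟩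
  · rw [← hedge a (by omega), ← hedge b (by omega)]
    exact fun h => hab (hc.isTrail.edges_nodup.getElem_inj_iff.mp h)
  · ext e
    simp only [Set.mem_inter_iff, Set.mem_ofPred_eq, Set.mem_insert_iff, Set.mem_singleton_iff]
    constructor
    · rintro ⟨he, hec⟩
      obtain ⟨i, hi, rfl⟩ := List.mem_iff_getElem.mp hec
      rw [hedge i hi] at he ⊢
      have h1 := (hcut i (by omega)).mp he
      rw [h i (by omega)] at h1
      by_cases hia : i = a
      · subst hia
        exact .inl rfl
      · by_cases hib : i = b
        · subst hib
          exact .inr rfl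
        · exact absurd ⟨hia, hib⟩ h1
    · rintro (rfl | rfl)
      · refine ⟨(hcut a ha).mpr fun h1 => ((h a ha).mp h1).1 rfl, ?_⟩
        rw [← hedge a (by omega)]
        exact List.getElem_mem _
      · refine ⟨(hcut b hb).mpr fun h1 => ((h b hb).mp h1).2 rfl, ?_⟩
        rw [← hedge b (by omega)]
        exact List.getElem_mem _

/-- The union of connected sets along a path is connected. -/
lemma conn_segment {g : ℕ → V} {W : ℕ → Set V} {s t : ℕ} (hst : s ≤ t)
    (hW : ∀ i, s ≤ i → i ≤ t → Conn G (W i) ∧ g i ∈ W i)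
    (hg : ∀ i, s ≤ i → i < t → G.Adj (g i) (g (i + 1))) :
    Conn G {v | ∃ i, s ≤ i ∧ i ≤ t ∧ v ∈ W i} := by
  induction t, hst using Nat.le_induction with
  | base =>
    convert (hW s le_rfl le_rfl).1 using 1
    ext u
    constructor
    · rintro ⟨i, h1, h2, h⟩
      obtain rfl : s = i := by omega
      exact h
    · exact fun h => ⟨s, le_rfl, le_rfl, h⟩
  | succ t hst ih =>
    have h1 := ih (fun i hi hi' => hW i hi (by omega)) (fun i hi hi' => hg i hi (by omega))
    have h2 := hW (t + 1) (by omega) le_rfl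
    convert h1.union h2.1 (x := g t) ⟨t, hst, le_rfl, (hW t hst (by omega)).2⟩ h2.2
      (.inr (hg t hst (by omega))) using 1
    ext u
    constructor
    · rintro ⟨i, hi, hi', h⟩
      by_cases hit : i = t + 1
      · exact .inr (hit ▸ h)
      · exact .inl ⟨i, hi, by omega, h⟩
    · rintro (⟨i, hi, hi', h⟩ | h)
      · exact ⟨i, hi, by omega, h⟩
      · exact ⟨t + 1, by omega, le_rfl, h⟩

/-- Any two pairs of positions on a cycle are simultaneously split by some arc. -/
lemma exists_splitting_arc {n i j k l : ℕ} (hi : i < n) (hj : j < n) (hk : k < n) (hl : l < n)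
    (hij : i ≠ j) (hkl : k ≠ l) :
    ∃ a b, a < b ∧ b < n ∧ ¬ ((a < i ∧ i ≤ b) ↔ (a < j ∧ j ≤ b)) ∧
      ¬ ((a < k ∧ k ≤ b) ↔ (a < l ∧ l ≤ b)) := by
  by_cases h : max (min i j) (min k l) < min (max i j) (max k l)
  · refine ⟨max (min i j) (min k l), n - 1, ?_, ?_, ?_, ?_⟩ <;> omega
  · refine ⟨min (min i j) (min k l), max (min i j) (min k l), ?_, ?_, ?_, ?_⟩ <;> omega

end Bonds

section Cycle

variable {G : SimpleGraph V} {p q v : V}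

/-- The conclusion of the main theorem: the four variants of some set `S` with respect to `p`
and `q` define bonds containing exactly two of the edges in `F`. -/
def HasFourBonds (G : SimpleGraph V) (F : Set (Sym2 V)) (p q : V) : Prop :=
  ∃ S : Set V, p ∉ S ∧ q ∉ S ∧
    ∀ T ∈ ({S, insert p S, insert q S, insert p (insert q S)} : Set (Set V)),
      IsBond G (cut G T) ∧ (cut G T ∩ F).ncard = 2

lemma HasFourBonds.symm {F : Set (Sym2 V)} (h : HasFourBonds G F p q) : HasFourBonds G F q p := by
  obtain ⟨S, hp, hq, h⟩ := h
  refine ⟨S, hq, hp, ?_⟩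
  rintro T (rfl | rfl | rfl | rfl)
  · exact h _ (by simp)
  · exact h _ (by simp)
  · exact h _ (by simp)
  · exact h _ (by simp [Set.insert_comm q p])

lemma cycle_getVert_inj {c : G.Walk v v} (hc : c.IsCycle) {i j : ℕ}
    (hi : i < c.length) (hj : j < c.length) (h : c.getVert i = c.getVert j) : i = j :=
  hc.getVert_injOn' (by simp; omega) (by simp; omega) h

lemma cycle_mem_support {c : G.Walk v v} (hc : c.IsCycle) {u : V} (hu : u ∈ c.support) :
    ∃ i < c.length, c.getVert i = u := by
  obtain ⟨i, rfl, hi⟩ := SimpleGraph.Walk.mem_support_iff_exists_getVert.mp hu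
  by_cases h : i = c.length
  · exact ⟨0, by have := hc.three_le_length; omega, by simp [h]⟩
  · exact ⟨i, by omega, rfl⟩

lemma cycle_getVert_eq_start {c : G.Walk v v} (hc : c.IsCycle) {i : ℕ} (hi : i ≤ c.length) :
    c.getVert i = v ↔ i = 0 ∨ i = c.length :=
  hc.getVert_endpoint_iff hi

lemma hasFourBonds_of_mem_of_mem [Finite V] (hW : ∀ W : Set V, W.ncard ≤ 2 → Conn G Wᶜ)
    {c : G.Walk p p} (hc : c.IsCycle) (hpq : G.Adj p q) (hf : s(p, q) ∉ c.edges)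
    (hq : q ∈ c.support) : HasFourBonds G {e | e ∈ c.edges} p q := by
  have hn := hc.three_le_length
  obtain ⟨k, hk, hkq⟩ := cycle_mem_support hc hq
  have hp : ∀ i ≤ c.length, c.getVert i = p ↔ i = 0 ∨ i = c.length := fun i hi =>
    cycle_getVert_eq_start hc hi
  have hq : ∀ i ≤ c.length, c.getVert i = q ↔ i = k := by
    intro i hi
    constructor
    · intro h
      by_cases hin : i = c.length
      · exact absurd ((hp i hi).mpr (.inr hin)) (h ▸ hpq.ne')
      · exact cycle_getVert_inj hc (by omega) hk (h.trans hkq.symm)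
    · rintro rfl
      exact hkq
  have hedge : ∀ i < c.length, s(c.getVert i, c.getVert (i + 1)) ∈ c.edges := by
    intro i hi
    have hi' : i < c.edges.length := by rwa [c.length_edges]
    rw [← SimpleGraph.Walk.getElem_edges hi']
    exact List.getElem_mem _
  have hk0 : k ≠ 0 := fun h => hpq.ne (by rw [← hkq, h, c.getVert_zero])
  have hk1 : k ≠ 1 := by
    intro h
    have : s(c.getVert 0, c.getVert 1) ∈ c.edges := hedge 0 (by omega)
    rw [c.getVert_zero, ← h, hkq] at this
    exact hf this
  have hkn : k ≠ c.length - 1 := by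
    intro h
    have := hedge k hk
    rw [hkq, show k + 1 = c.length by omega, c.getVert_length, Sym2.eq_swap] at this
    exact hf this
  have hadj : ∀ i < c.length, G.Adj (c.getVert i) (c.getVert (i + 1)) := fun i hi =>
    c.adj_getVert_succ hi
  have hseg : ∀ s t, s ≤ t → t < c.length →
      Conn G {v | ∃ i, s ≤ i ∧ i ≤ t ∧ v ∈ ({c.getVert i} : Set V)} := fun s t hst ht =>
    conn_segment hst (fun i _ _ => ⟨conn_singleton, rfl⟩) fun i _ hi => hadj i (by omega)
  have hU : ∀ s t, 0 < s → t < c.length → (t < k ∨ k < s) →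
      {v | ∃ i, s ≤ i ∧ i ≤ t ∧ v ∈ ({c.getVert i} : Set V)} ⊆ {p, q}ᶜ := by
    rintro s t hs ht hst u ⟨i, h1, h2, rfl⟩ hu
    simp only [Set.mem_insert_iff, Set.mem_singleton_iff] at hu
    rw [hp i (by omega), hq i (by omega)] at hu
    omega
  obtain ⟨S, hpS, hqS, hA, hB, h⟩ := exists_bonds hpq.ne (hW _ (ncard_pair_le p q))
    (hU 1 (k - 1) (by omega) (by omega) (by omega))
    (hU (k + 1) (c.length - 1) (by omega) (by omega) (by omega))
    (hseg _ _ (by omega) (by omega)) (hseg _ _ (by omega) (by omega))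
    (Set.disjoint_left.mpr (by
      rintro u ⟨i, h1, h2, rfl⟩ ⟨j, h3, h4, hij⟩
      have := cycle_getVert_inj hc (by omega) (by omega) hij
      omega)) hpq
    ⟨c.getVert 1, ⟨1, by omega, by omega, rfl⟩, by simpa using hadj 0 (by omega)⟩
    ⟨c.getVert (c.length - 1), ⟨_, by omega, by omega, rfl⟩, by
      have := hadj (c.length - 1) (by omega)
      rw [show c.length - 1 + 1 = c.length by omega, c.getVert_length] at this
      exact this.symm⟩
    ⟨c.getVert (k - 1), ⟨_, by omega, by omega, rfl⟩, by
      have := hadj (k - 1) (by omega)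
      rw [show k - 1 + 1 = k by omega, hkq] at this
      exact this.symm⟩
    ⟨c.getVert (k + 1), ⟨_, by omega, by omega, rfl⟩, by
      have := hadj k (by omega)
      rwa [hkq] at this⟩
  have hS : ∀ i ≤ c.length, c.getVert i ∈ S ↔ 0 < i ∧ i < k := by
    intro i hi
    by_cases h0 : c.getVert i = p
    · have h0' := (hp i hi).mp h0
      rw [h0]
      exact ⟨fun h => absurd h hpS, fun h => by omega⟩
    · by_cases h1 : c.getVert i = q
      · have h1' := (hq i hi).mp h1
        rw [h1]
        exact ⟨fun h => absurd h hqS, fun h => by omega⟩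
      · rw [hp i hi] at h0
        rw [hq i hi] at h1
        by_cases h2 : i < k
        · exact ⟨fun _ => by omega, fun _ => hA ⟨i, by omega, by omega, rfl⟩⟩
        · exact ⟨fun h => absurd h (hB _ ⟨i, by omega, by omega, rfl⟩), fun h => by omega⟩
  refine ⟨S, hpS, hqS, fun T hT => ⟨h T hT, ?_⟩⟩
  rcases hT with rfl | rfl | rfl | rfl
  · refine ncard_cut_inter_edges hc (a := 0) (b := k - 1) (by omega) (by omega) (by omega)
      fun i hi => ?_
    rw [hS i (by omega), hS (i + 1) (by omega)]
    omega
  · refine ncard_cut_inter_edges hc (a := k - 1) (b := c.length - 1) (by omega) (by omega)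
      (by omega) fun i hi => ?_
    rw [Set.mem_insert_iff, Set.mem_insert_iff, hS i (by omega), hS (i + 1) (by omega),
      hp i (by omega), hp (i + 1) (by omega)]
    omega
  · refine ncard_cut_inter_edges hc (a := 0) (b := k) (by omega) (by omega) (by omega)
      fun i hi => ?_
    rw [Set.mem_insert_iff, Set.mem_insert_iff, hS i (by omega), hS (i + 1) (by omega),
      hq i (by omega), hq (i + 1) (by omega)]
    omega
  · refine ncard_cut_inter_edges hc (a := k) (b := c.length - 1) (by omega) (by omega) (by omega)
      fun i hi => ?_
    rw [Set.mem_insert_iff, Set.mem_insert_iff, Set.mem_insert_iff, Set.mem_insert_iff,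
      hS i (by omega), hS (i + 1) (by omega),
      hp i (by omega), hp (i + 1) (by omega), hq i (by omega), hq (i + 1) (by omega)]
    omega

lemma hasFourBonds_of_mem_of_notMem [Finite V] (hW : ∀ W : Set V, W.ncard ≤ 2 → Conn G Wᶜ)
    {c : G.Walk p p} (hc : c.IsCycle) (hpq : G.Adj p q)
    (hq : q ∉ c.support) : HasFourBonds G {e | e ∈ c.edges} p q := by
  have hn := hc.three_le_length
  have hp : ∀ i ≤ c.length, c.getVert i = p ↔ i = 0 ∨ i = c.length := fun i hi =>
    cycle_getVert_eq_start hc hi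
  have hq' : ∀ i, c.getVert i ≠ q := fun i h => hq (h ▸ c.getVert_mem_support i)
  have hadj : ∀ i < c.length, G.Adj (c.getVert i) (c.getVert (i + 1)) := fun i hi =>
    c.adj_getVert_succ hi
  let X : Set V := {u | ∃ i, 0 < i ∧ i < c.length ∧ c.getVert i = u}
  have hXi : ∀ i, 0 < i → i < c.length → c.getVert i ∈ X := fun i h1 h2 => ⟨i, h1, h2, rfl⟩
  have hXU : X ⊆ {p, q}ᶜ := by
    rintro u ⟨i, h1, h2, rfl⟩ (hu | hu)
    · rw [hp i (by omega)] at hu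
      omega
    · exact hq' i hu
  have hX2 : 2 ≤ X.ncard := by
    refine (Set.one_lt_ncard (Set.toFinite X)).mpr ⟨_, hXi 1 (by omega) (by omega), _,
      hXi 2 (by omega) (by omega), fun h => ?_⟩
    have := cycle_getVert_inj hc (by omega) (by omega) h
    omega
  obtain ⟨r, hr, hu⟩ := exists_retraction_two hW hpq.ne hXU hX2
  obtain ⟨u₁, u₂, j₁, j₂, hj₁, hj, hj₂, hu₁, hu₂, hq₁, hq₂, hr₁, hr₂⟩ : ∃ u₁ u₂ j₁ j₂, 0 < j₁ ∧
      j₁ < j₂ ∧ j₂ < c.length ∧ u₁ ∈ ({p, q}ᶜ : Set V) ∧ u₂ ∈ ({p, q}ᶜ : Set V) ∧ G.Adj q u₁ ∧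
      G.Adj q u₂ ∧ r u₁ = c.getVert j₁ ∧ r u₂ = c.getVert j₂ := by
    obtain ⟨n, ⟨hnU, hn⟩, n', ⟨hnU', hn'⟩, hne⟩ := hu
    obtain ⟨i, hi, hi', hir⟩ := hr.maps n hnU
    obtain ⟨j, hj, hj', hjr⟩ := hr.maps n' hnU'
    rcases lt_trichotomy i j with h | rfl | h
    · exact ⟨n, n', i, j, hi, h, hj', hnU, hnU', hn, hn', hir.symm, hjr.symm⟩
    · exact absurd (hir.symm.trans hjr) hne
    · exact ⟨n', n, j, i, hj, h, hi', hnU', hnU, hn', hn, hjr.symm, hir.symm⟩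
  let W : ℕ → Set V := fun i => {u | u ∈ ({p, q}ᶜ : Set V) ∧ r u = c.getVert i}
  have hgW : ∀ i, 0 < i → i < c.length → c.getVert i ∈ W i := fun i h1 h2 =>
    ⟨hXU (hXi i h1 h2), hr.fix _ (hXi i h1 h2)⟩
  have hseg : ∀ s t, 0 < s → s ≤ t → t < c.length →
      Conn G {v | ∃ i, s ≤ i ∧ i ≤ t ∧ v ∈ W i} := fun s t hs hst ht =>
    conn_segment hst (fun i h1 h2 => ⟨hr.conn _ (hXi i (by omega) (by omega)),
      hgW i (by omega) (by omega)⟩) fun i _ hi => hadj i (by omega)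
  have hU : ∀ s t, {v | ∃ i, s ≤ i ∧ i ≤ t ∧ v ∈ W i} ⊆ {p, q}ᶜ := by
    rintro s t u ⟨i, h1, h2, h3⟩
    exact h3.1
  obtain ⟨S, hpS, hqS, hA, hB, h⟩ := exists_bonds hpq.ne (hW _ (ncard_pair_le p q))
    (hU 1 j₁) (hU (j₁ + 1) (c.length - 1))
    (hseg _ _ (by omega) (by omega) (by omega)) (hseg _ _ (by omega) (by omega) (by omega))
    (Set.disjoint_left.mpr (by
      rintro u ⟨i, h1, h2, h5⟩ ⟨j, h3, h4, h6⟩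
      have := cycle_getVert_inj hc (by omega) (by omega) (h5.2.symm.trans h6.2)
      omega)) hpq
    ⟨c.getVert 1, ⟨1, by omega, by omega, hgW _ (by omega) (by omega)⟩,
      by simpa using hadj 0 (by omega)⟩
    ⟨c.getVert (c.length - 1), ⟨_, by omega, by omega, hgW _ (by omega) (by omega)⟩, by
      have := hadj (c.length - 1) (by omega)
      rw [show c.length - 1 + 1 = c.length by omega, c.getVert_length] at this
      exact this.symm⟩
    ⟨u₁, ⟨j₁, by omega, by omega, hu₁, hr₁⟩, hq₁⟩
    ⟨u₂, ⟨j₂, by omega, by omega, hu₂, hr₂⟩, hq₂⟩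
  have hS : ∀ i ≤ c.length, c.getVert i ∈ S ↔ 0 < i ∧ i ≤ j₁ := by
    intro i hi
    by_cases h0 : c.getVert i = p
    · have h0' := (hp i hi).mp h0
      rw [h0]
      exact ⟨fun h => absurd h hpS, fun h => by omega⟩
    · rw [hp i hi] at h0
      have hi := hgW i (by omega) (by omega)
      by_cases h2 : i ≤ j₁
      · exact ⟨fun _ => by omega, fun _ => hA ⟨i, by omega, by omega, hi⟩⟩
      · exact ⟨fun h => absurd h (hB _ ⟨i, by omega, by omega, hi⟩), fun h => by omega⟩
  have hcount : ∀ T : Set V, (∀ i ≤ c.length, c.getVert i ∈ T ↔ c.getVert i ∈ S) →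
      (cut G T ∩ {e | e ∈ c.edges}).ncard = 2 := by
    intro T hT
    refine ncard_cut_inter_edges hc (a := 0) (b := j₁) (by omega) (by omega) (by omega)
      fun i hi => ?_
    rw [hT i (by omega), hT (i + 1) (by omega), hS i (by omega), hS (i + 1) (by omega)]
    omega
  have hcount' : ∀ T : Set V,
      (∀ i ≤ c.length, c.getVert i ∈ T ↔ c.getVert i = p ∨ c.getVert i ∈ S) →
      (cut G T ∩ {e | e ∈ c.edges}).ncard = 2 := by
    intro T hT
    refine ncard_cut_inter_edges hc (a := j₁) (b := c.length - 1) (by omega) (by omega) (by omega)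
      fun i hi => ?_
    rw [hT i (by omega), hT (i + 1) (by omega), hS i (by omega), hS (i + 1) (by omega),
      hp i (by omega), hp (i + 1) (by omega)]
    omega
  refine ⟨S, hpS, hqS, fun T hT => ⟨h T hT, ?_⟩⟩
  rcases hT with rfl | rfl | rfl | rfl
  · exact hcount _ fun i _ => Iff.rfl
  · exact hcount' _ fun i _ => Iff.rfl
  · exact hcount _ fun i _ => by simp [hq' i]
  · exact hcount' _ fun i _ => by simp [hq' i]

lemma hasFourBonds_of_notMem_of_notMem [Finite V] (hW : ∀ W : Set V, W.ncard ≤ 2 → Conn G Wᶜ)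
    {c : G.Walk v v} (hc : c.IsCycle) (hpq : G.Adj p q) (hp : p ∉ c.support)
    (hq : q ∉ c.support) : HasFourBonds G {e | e ∈ c.edges} p q := by
  have hn := hc.three_le_length
  have hp' : ∀ i, c.getVert i ≠ p := fun i h => hp (h ▸ c.getVert_mem_support i)
  have hq' : ∀ i, c.getVert i ≠ q := fun i h => hq (h ▸ c.getVert_mem_support i)
  have hadj : ∀ i < c.length, G.Adj (c.getVert i) (c.getVert (i + 1)) := fun i hi =>
    c.adj_getVert_succ hi
  have hcl : c.getVert c.length = c.getVert 0 := by rw [c.getVert_length, c.getVert_zero]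
  let X : Set V := {u | ∃ i < c.length, c.getVert i = u}
  have hXi : ∀ i ≤ c.length, c.getVert i ∈ X := by
    intro i hi
    by_cases h : i = c.length
    · exact ⟨0, by omega, by rw [h, hcl]⟩
    · exact ⟨i, by omega, rfl⟩
  have hXU : X ⊆ {p, q}ᶜ := by
    rintro u ⟨i, h2, rfl⟩ (hu | hu)
    · exact hp' i hu
    · exact hq' i hu
  have hX3 : 3 ≤ X.ncard := by
    refine (Set.two_lt_ncard_iff (Set.toFinite X)).mpr ⟨_, _, _, hXi 0 (by omega),
      hXi 1 (by omega), hXi 2 (by omega), ?_, ?_, ?_⟩ <;>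
    · intro h
      have := cycle_getVert_inj hc (by omega) (by omega) h
      omega
  obtain ⟨r, hr, ⟨u₁, ⟨hu₁, hpu₁⟩, u₂, ⟨hu₂, hpu₂⟩, hne⟩, ⟨w₁, ⟨hw₁, hqw₁⟩, w₂, ⟨hw₂, hqw₂⟩, hne'⟩⟩ :=
    exists_retraction_two_two hW hpq.ne hXU hX3
  obtain ⟨i₁, hi₁, hri₁⟩ := hr.maps u₁ hu₁
  obtain ⟨i₂, hi₂, hri₂⟩ := hr.maps u₂ hu₂
  obtain ⟨j₁, hj₁, hrj₁⟩ := hr.maps w₁ hw₁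
  obtain ⟨j₂, hj₂, hrj₂⟩ := hr.maps w₂ hw₂
  obtain ⟨a, b, hab, hb, hi, hj⟩ := exists_splitting_arc hi₁ hi₂ hj₁ hj₂
    (fun h => hne (by rw [← hri₁, ← hri₂, h])) (fun h => hne' (by rw [← hrj₁, ← hrj₂, h]))
  let W : ℕ → Set V := fun i => {u | u ∈ ({p, q}ᶜ : Set V) ∧ r u = c.getVert i}
  have hgW : ∀ i ≤ c.length, c.getVert i ∈ W i := fun i h =>
    ⟨hXU (hXi i h), hr.fix _ (hXi i h)⟩
  have hseg : ∀ s t, s ≤ t → t ≤ c.length →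
      Conn G {v | ∃ i, s ≤ i ∧ i ≤ t ∧ v ∈ W i} := fun s t hst ht =>
    conn_segment hst (fun i h1 h2 => ⟨hr.conn _ (hXi i (by omega)), hgW i (by omega)⟩)
      fun i _ hi => hadj i (by omega)
  have hU : ∀ s t, {v | ∃ i, s ≤ i ∧ i ≤ t ∧ v ∈ W i} ⊆ {p, q}ᶜ := by
    rintro s t u ⟨i, h1, h2, h3⟩
    exact h3.1
  set A : Set V := {v | ∃ i, a + 1 ≤ i ∧ i ≤ b ∧ v ∈ W i} with hAdef
  set B : Set V := {v | ∃ i, b + 1 ≤ i ∧ i ≤ c.length ∧ v ∈ W i} ∪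
    {v | ∃ i, 0 ≤ i ∧ i ≤ a ∧ v ∈ W i} with hBdef
  have hBc : Conn G B := (hseg _ _ (by omega) le_rfl).union (hseg _ _ (by omega) (by omega))
    (x := c.getVert c.length) ⟨_, by omega, le_rfl, hgW _ le_rfl⟩
    (y := c.getVert 0) ⟨0, le_rfl, by omega, hgW _ (by omega)⟩ (.inl hcl)
  have hAB : Disjoint A B := by
    refine Set.disjoint_left.mpr ?_
    rintro u ⟨i, h1, h2, h5⟩ (⟨j, h3, h4, h6⟩ | ⟨j, h3, h4, h6⟩)
    · have hij := h5.2.symm.trans h6.2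
      by_cases hjn : j = c.length
      · rw [hjn, hcl] at hij
        have := cycle_getVert_inj hc (by omega) (by omega) hij
        omega
      · have := cycle_getVert_inj hc (by omega) (by omega) hij
        omega
    · have := cycle_getVert_inj hc (by omega) (by omega) (h5.2.symm.trans h6.2)
      omega
  have hmemA : ∀ i u, u ∈ W i → a < i ∧ i ≤ b → u ∈ A := fun i u hu hi =>
    ⟨i, by omega, by omega, hu⟩
  have hmemB : ∀ i ≤ c.length, ∀ u, u ∈ W i → ¬ (a < i ∧ i ≤ b) → u ∈ B := by
    intro i hin u hu hi
    by_cases h : i ≤ a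
    · exact .inr ⟨i, by omega, h, hu⟩
    · exact .inl ⟨i, by omega, hin, hu⟩
  have hmark : ∀ z u u' i i', G.Adj z u → G.Adj z u' → u ∈ W i → u' ∈ W i' → i < c.length →
      i' < c.length → ¬ ((a < i ∧ i ≤ b) ↔ (a < i' ∧ i' ≤ b)) →
      (∃ x ∈ A, G.Adj z x) ∧ ∃ x ∈ B, G.Adj z x := by
    intro z u u' i i' hu hu' hui hui' hi hi' h
    by_cases h1 : a < i ∧ i ≤ b
    · have h2 : ¬ (a < i' ∧ i' ≤ b) := fun h2 => h ⟨fun _ => h2, fun _ => h1⟩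
      exact ⟨⟨u, hmemA _ _ hui h1, hu⟩, ⟨u', hmemB _ (by omega) _ hui' h2, hu'⟩⟩
    · have h2 : a < i' ∧ i' ≤ b := by
        by_contra h2
        exact h ⟨fun h3 => absurd h3 h1, fun h3 => absurd h3 h2⟩
      exact ⟨⟨u', hmemA _ _ hui' h2, hu'⟩, ⟨u, hmemB _ (by omega) _ hui h1, hu⟩⟩
  obtain ⟨hpA, hpB⟩ := hmark p u₁ u₂ i₁ i₂ hpu₁ hpu₂ ⟨hu₁, hri₁.symm⟩ ⟨hu₂, hri₂.symm⟩ hi₁ hi₂ hi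
  obtain ⟨hqA, hqB⟩ := hmark q w₁ w₂ j₁ j₂ hqw₁ hqw₂ ⟨hw₁, hrj₁.symm⟩ ⟨hw₂, hrj₂.symm⟩ hj₁ hj₂ hj
  obtain ⟨S, hpS, hqS, hA, hB, h⟩ := exists_bonds hpq.ne (hW _ (ncard_pair_le p q))
    (hU _ _) (Set.union_subset (hU _ _) (hU _ _)) (hseg _ _ (by omega) (by omega)) hBc
    hAB hpq hpA hpB hqA hqB
  have hS : ∀ i ≤ c.length, c.getVert i ∈ S ↔ a < i ∧ i ≤ b := by
    intro i hi
    by_cases h2 : a < i ∧ i ≤ b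
    · exact ⟨fun _ => h2, fun _ => hA (hmemA _ _ (hgW i hi) h2)⟩
    · exact ⟨fun h => absurd h (hB _ (hmemB _ hi _ (hgW i hi) h2)), fun h => absurd h h2⟩
  have hcount : ∀ T : Set V, (∀ i ≤ c.length, c.getVert i ∈ T ↔ c.getVert i ∈ S) →
      (cut G T ∩ {e | e ∈ c.edges}).ncard = 2 := by
    intro T hT
    refine ncard_cut_inter_edges hc (a := a) (b := b) (by omega) (by omega) (by omega)
      fun i hi => ?_
    rw [hT i (by omega), hT (i + 1) (by omega), hS i (by omega), hS (i + 1) (by omega)]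
    omega
  refine ⟨S, hpS, hqS, fun T hT => ⟨h T hT, hcount T fun i _ => ?_⟩⟩
  rcases hT with rfl | rfl | rfl | rfl <;> simp [hp' i, hq' i]

end Cycle

theorem exists_set_giving_four_bonds {V : Type*} [Fintype V] [DecidableEq V]
    (G : SimpleGraph V) [DecidableRel G.Adj] (h3 : ThreeConnected G)
    (v : V) (c : G.Walk v v) (hc : c.IsCycle)
    (p q : V) (hpq : G.Adj p q) (hf : s(p, q) ∉ c.edges) :
    ∃ S : Set V, p ∉ S ∧ q ∉ S ∧
      ∀ T ∈ ({S, insert p S, insert q S, insert p (insert q S)} : Set (Set V)),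
        IsBond G (cut G T) ∧ (cut G T ∩ {e | e ∈ c.edges}).ncard = 2 := by
  classical
  have hW : ∀ W : Set V, W.ncard ≤ 2 → Conn G Wᶜ := fun W hWc =>
    conn_of_preconnected (h3.2 W hWc).preconnected
  have hrot : ∀ (x : V) (hx : x ∈ c.support),
      {e | e ∈ (c.rotate x hx).edges} = {e | e ∈ c.edges} := fun x hx =>
    Set.ext fun e => (c.rotate_edges x hx).mem_iff
  suffices H : HasFourBonds G {e | e ∈ c.edges} p q from H
  by_cases hp : p ∈ c.support
  · rw [← hrot p hp]
    by_cases hq : q ∈ c.support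
    · exact hasFourBonds_of_mem_of_mem hW (hc.rotate hp) hpq
        (fun h => hf ((Set.ext_iff.mp (hrot p hp) _).mp h)) (by simpa using hq)
    · exact hasFourBonds_of_mem_of_notMem hW (hc.rotate hp) hpq (by simpa using hq)
  · by_cases hq : q ∈ c.support
    · rw [← hrot q hq]
      exact (hasFourBonds_of_mem_of_notMem hW (hc.rotate hq) hpq.symm (by simpa using hp)).symm
    · exact hasFourBonds_of_notMem_of_notMem hW hc hpq hp hq

end BondPolytope
end
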